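/- arXiv:2602.06756 — 2 statements merged into one kernel-verified Lean document; each statement's English description precedes it below -/
import Mathlib

section
/- There exist constants C > 0, ε ∈ (0,1) and σ₀ > 0, depending on n and g₀,…,g_n, such that for all q ∈ (0,1) with q̂ = 1 − q ≤ ε and all σ ≥ σ₀: |E_{P_{q,σ}}[L_{q,σ}] − (1/2)·q²·μ²/σ²| ≤ C·(q̂/σ⁴ + q̂²) and |E_{Q_{q,σ}}[L_{q,σ}] + (1/2)·q²·μ²/σ²| ≤ C·(q̂/σ⁴ + q̂²). That is, in the joint limit q̂ → 0 and σ → ∞, the mean of the privacy loss under P is (1/2)q²μ²/σ² + q̂·O(1/σ⁴) + O(q̂²) and under Q is −(1/2)q²μ²/σ² + q̂·O(1/σ⁴) + O(q̂²). -/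
open MeasureTheory ProbabilityTheory

/-- The summation dataset function `h(J) = Σ_{j∈J} g j`. -/
noncomputable def sumFn (g : ℕ → ℝ) : Finset ℕ → ℝ := fun J => ∑ j ∈ J, g j

/-- The Poisson-subsampled Gaussian output distribution on the dataset `S = {0,…,n}`:
`P_{q,σ} = Σ_{J ⊆ {0,…,n}} q^{|J|} (1−q)^{n+1−|J|} · N(h(J), σ²)`. -/
noncomputable def subsampledP (n : ℕ) (σ q : ℝ) (h : Finset ℕ → ℝ) : Measure ℝ :=
  ∑ J ∈ (Finset.range (n + 1)).powerset,
    ENNReal.ofReal (q ^ J.card * (1 - q) ^ (n + 1 - J.card)) •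
      gaussianReal (h J) (σ ^ 2).toNNReal

/-- The Poisson-subsampled Gaussian output distribution on the dataset
`S⁻ = {0,…,n−1}`:
`Q_{q,σ} = Σ_{J ⊆ {0,…,n−1}} q^{|J|} (1−q)^{n−|J|} · N(h(J), σ²)`. -/
noncomputable def subsampledQ (n : ℕ) (σ q : ℝ) (h : Finset ℕ → ℝ) : Measure ℝ :=
  ∑ J ∈ (Finset.range n).powerset,
    ENNReal.ofReal (q ^ J.card * (1 - q) ^ (n - J.card)) •
      gaussianReal (h J) (σ ^ 2).toNNReal

/-- The privacy loss `L_{q,σ} = ln(dP_{q,σ}/dQ_{q,σ})` of the Poisson-subsampled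
Gaussian mechanism. -/
noncomputable def privacyLoss (n : ℕ) (σ q : ℝ) (h : Finset ℕ → ℝ) (y : ℝ) : ℝ :=
  Real.log (((subsampledP n σ q h).rnDeriv (subsampledQ n σ q h) y).toReal)


noncomputable def er (σ c x y : ℝ) : ℝ :=
  Real.exp ((x - c) * (y - c) / σ ^ 2 - (x - c) ^ 2 / (2 * σ ^ 2))

lemma er_pos (σ c x y : ℝ) : 0 < er σ c x y := Real.exp_pos _

lemma er_self (σ c y : ℝ) : er σ c c y = 1 := by simp [er]

lemma er_measurable (σ c x : ℝ) : Measurable (er σ c x) := by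
  unfold er; fun_prop

lemma er_mul (σ c c' x y : ℝ) (hσ : 0 < σ) : er σ c x y = er σ c c' y * er σ c' x y := by
  unfold er
  rw [← Real.exp_add]
  congr 1
  field_simp
  ring

lemma v_ne (σ : ℝ) (hσ : 0 < σ) : (σ ^ 2).toNNReal ≠ 0 := by

  simp [hσ.ne']

lemma gauss_er (σ c x : ℝ) (hσ : 0 < σ) :
    gaussianReal x (σ ^ 2).toNNReal =
      (gaussianReal c (σ ^ 2).toNNReal).withDensity (fun y => ENNReal.ofReal (er σ c x y)) := by
  rw [gaussianReal_of_var_ne_zero _ (v_ne σ hσ), gaussianReal_of_var_ne_zero _ (v_ne σ hσ),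
    ← withDensity_mul _ (measurable_gaussianPDF _ _) (er_measurable σ c x).ennreal_ofReal]
  congr 1
  ext y
  simp only [Pi.mul_apply, gaussianPDF]
  rw [← ENNReal.ofReal_mul (gaussianPDFReal_nonneg _ _ _)]
  congr 1
  have h2 : (((σ ^ 2).toNNReal : NNReal) : ℝ) = σ ^ 2 := Real.coe_toNNReal _ (by positivity)
  simp only [gaussianPDFReal, h2, er, mul_assoc]
  rw [← Real.exp_add]
  congr 2
  field_simp
  ring

lemma lin_exp_integral (σ m α β : ℝ) :
    Integrable (fun y => Real.exp (α * y + β)) (gaussianReal m (σ ^ 2).toNNReal) ∧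
    ∫ y, Real.exp (α * y + β) ∂(gaussianReal m (σ ^ 2).toNNReal)
      = Real.exp (m * α + σ ^ 2 * α ^ 2 / 2 + β) := by
  have h2 : (((σ ^ 2).toNNReal : NNReal) : ℝ) = σ ^ 2 := Real.coe_toNNReal _ (by positivity)
  have h3 := congrFun (mgf_id_gaussianReal (μ := m) (v := (σ ^ 2).toNNReal)) α
  simp only [mgf, id, h2] at h3
  simp only [Real.exp_add _ β]
  refine ⟨(integrable_exp_mul_gaussianReal α).mul_const _, ?_⟩
  rw [integral_mul_const, h3]

lemma er_integral (σ c x m : ℝ) (hσ : 0 < σ) :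
    Integrable (er σ c x) (gaussianReal m (σ ^ 2).toNNReal) ∧
    ∫ y, er σ c x y ∂(gaussianReal m (σ ^ 2).toNNReal) = Real.exp ((x - c) * (m - c) / σ ^ 2) := by
  have h := lin_exp_integral σ m ((x - c) / σ ^ 2)
    (- (x - c) * c / σ ^ 2 - (x - c) ^ 2 / (2 * σ ^ 2))
  have e : er σ c x = fun y => Real.exp (((x - c) / σ ^ 2) * y +
      (- (x - c) * c / σ ^ 2 - (x - c) ^ 2 / (2 * σ ^ 2))) := by
    ext y; unfold er; congr 1; field_simp; ring
  rw [e]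
  refine ⟨h.1, h.2.trans ?_⟩
  congr 1; field_simp; ring

lemma er_sq_integral (σ c x m : ℝ) (hσ : 0 < σ) :
    Integrable (fun y => er σ c x y ^ 2) (gaussianReal m (σ ^ 2).toNNReal) ∧
    ∫ y, er σ c x y ^ 2 ∂(gaussianReal m (σ ^ 2).toNNReal)
      = Real.exp ((2 * (x - c) * (m - c) + (x - c) ^ 2) / σ ^ 2) := by
  have h := lin_exp_integral σ m (2 * (x - c) / σ ^ 2)
    (- 2 * (x - c) * c / σ ^ 2 - (x - c) ^ 2 / (σ ^ 2))
  have e : (fun y => er σ c x y ^ 2) = fun y => Real.exp ((2 * (x - c) / σ ^ 2) * y +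
      (- 2 * (x - c) * c / σ ^ 2 - (x - c) ^ 2 / (σ ^ 2))) := by
    ext y; unfold er; rw [← Real.exp_nat_mul]; congr 1; field_simp; push_cast; ring
  rw [e]
  refine ⟨h.1, h.2.trans ?_⟩
  congr 1; field_simp; ring

lemma log_one_add_bound (r : ℝ) (hr : -(1 / 2) ≤ r) : |Real.log (1 + r) - r| ≤ r ^ 2 * 2 := by
  have h0 : 0 < 1 + r := by linarith
  have h1 := Real.log_le_sub_one_of_pos h0
  have h2 := Real.one_sub_inv_le_log_of_pos h0
  have h3 : 1 - (1 + r)⁻¹ = r - r ^ 2 * (1 + r)⁻¹ := by field_simp; ring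
  have h4 : (1 + r)⁻¹ ≤ 2 := by
    rw [inv_le_comm₀ h0 (by norm_num)]; linarith
  rw [abs_le]
  constructor
  · nlinarith [sq_nonneg r]
  · nlinarith [sq_nonneg r]

/-- key single-Gaussian estimate -/
lemma key {ι : Type*} [DecidableEq ι] (s : Finset ι) (i0 : ι) (hi0 : i0 ∈ s) (w x : ι → ℝ)
    (B δ σ m c : ℝ) (hw : ∀ i ∈ s, 0 ≤ w i) (hw1 : ∑ i ∈ s, w i = 1) (hw0 : 1 / 2 ≤ w i0)
    (hδ : 1 - w i0 ≤ δ) (hx : ∀ i ∈ s, |x i| ≤ B) (hm : |m| ≤ B) (hc : x i0 = c)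
    (hσ : 2 * B + 1 ≤ σ) :
    Integrable (fun y => Real.log (∑ i ∈ s, w i * er σ c (x i) y))
      (gaussianReal m (σ ^ 2).toNNReal) ∧
    |∫ y, Real.log (∑ i ∈ s, w i * er σ c (x i) y) ∂(gaussianReal m (σ ^ 2).toNNReal)
      - (∑ i ∈ s, w i * x i - c) * (m - c) / σ ^ 2| ≤
      16 * B ^ 4 * (δ / σ ^ 4) + 2 * (Real.exp 3 + 1) * δ ^ 2 := by
  have hB : 0 ≤ B := (abs_nonneg _).trans hm
  have hσ0 : 0 < σ := by linarith
  have hcB : |c| ≤ B := hc ▸ hx i0 hi0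
  set γ := gaussianReal m (σ ^ 2).toNNReal with hγ
  set R : ℝ → ℝ := fun y => ∑ i ∈ s.erase i0, w i * (er σ c (x i) y - 1) with hR
  have hwe : ∑ i ∈ s.erase i0, w i = 1 - w i0 := by
    rw [← hw1, ← Finset.add_sum_erase s w hi0]; ring
  have hwn : ∀ i ∈ s.erase i0, 0 ≤ w i := fun i hi => hw i (Finset.mem_of_mem_erase hi)
  have hδ0 : 0 ≤ 1 - w i0 := hwe ▸ Finset.sum_nonneg hwn
  have hS : ∀ y, ∑ i ∈ s, w i * er σ c (x i) y = 1 + R y := by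
    intro y
    rw [← Finset.add_sum_erase s _ hi0, hc, er_self]
    simp only [hR, mul_sub, mul_one, Finset.sum_sub_distrib, hwe]
    ring
  have hRlow : ∀ y, -(1 / 2) ≤ R y := by
    intro y
    have : ∑ i ∈ s.erase i0, (- w i) ≤ R y := by
      refine Finset.sum_le_sum fun i hi => ?_
      have := mul_nonneg (hwn i hi) (er_pos σ c (x i) y).le
      linarith
    rw [Finset.sum_neg_distrib, hwe] at this
    linarith
  have hRsq : ∀ y, R y ^ 2 ≤ δ * ∑ i ∈ s.erase i0, w i * (er σ c (x i) y ^ 2 + 1) := by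
    intro y
    have h1 : R y ^ 2 ≤ (∑ i ∈ s.erase i0, w i) *
        ∑ i ∈ s.erase i0, w i * (er σ c (x i) y ^ 2 + 1) := by
      refine Finset.sum_sq_le_sum_mul_sum_of_sq_le_mul _ hwn ?_ ?_
      · intro i hi; have := hwn i hi; positivity
      · intro i hi
        have h1 := hwn i hi
        have h2 := er_pos σ c (x i) y
        have h3 : (er σ c (x i) y - 1) ^ 2 ≤ er σ c (x i) y ^ 2 + 1 := by nlinarith
        calc (w i * (er σ c (x i) y - 1)) ^ 2 = w i ^ 2 * (er σ c (x i) y - 1) ^ 2 := by ring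
          _ ≤ w i ^ 2 * (er σ c (x i) y ^ 2 + 1) := by gcongr
          _ = _ := by ring
    refine h1.trans ?_
    rw [hwe]
    refine mul_le_mul_of_nonneg_right hδ (Finset.sum_nonneg fun i hi => ?_)
    have := hwn i hi; positivity
  have hσ2 : (2 * B) ^ 2 ≤ σ ^ 2 := by gcongr; linarith
  have hd : ∀ i ∈ s, ∀ z : ℝ, |z| ≤ B → |(x i - c) * (z - c)| ≤ (2 * B) ^ 2 := by
    intro i hi z hz
    rw [abs_mul, sq]
    have h1 : |x i - c| ≤ 2 * B := (abs_sub _ _).trans (by linarith [hx i hi])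
    have h2 : |z - c| ≤ 2 * B := (abs_sub _ _).trans (by linarith)
    gcongr
  have hI1 : ∀ i, Integrable (fun y => w i * (er σ c (x i) y - 1)) γ := fun i =>
    (((er_integral σ c (x i) m hσ0).1).sub (integrable_const _)).const_mul _
  have hI2 : ∀ i, Integrable (fun y => w i * (er σ c (x i) y ^ 2 + 1)) γ := fun i =>
    (((er_sq_integral σ c (x i) m hσ0).1).add (integrable_const _)).const_mul _
  have hRint : Integrable R γ :=
    integrable_finsetSum _ fun i _ =>
      (((er_integral σ c (x i) m hσ0).1).sub (integrable_const _)).const_mul _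
  have hDint : Integrable (fun y => δ * ∑ i ∈ s.erase i0, w i * (er σ c (x i) y ^ 2 + 1)) γ :=
    (integrable_finsetSum _ fun i _ =>
      (((er_sq_integral σ c (x i) m hσ0).1).add (integrable_const _)).const_mul _).const_mul _
  have hRm : Measurable R := by
    have := fun i => er_measurable σ c (x i)
    fun_prop
  have hdiff : ∀ y, |Real.log (1 + R y) - R y| ≤
      2 * (δ * ∑ i ∈ s.erase i0, w i * (er σ c (x i) y ^ 2 + 1)) := fun y =>
    (log_one_add_bound _ (hRlow y)).trans (by linarith [hRsq y])
  have hEint : Integrable (fun y => Real.log (1 + R y) - R y) γ := by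
    refine (hDint.const_mul 2).mono' ?_ (ae_of_all _ hdiff)
    exact ((Real.measurable_log.comp (measurable_const.add hRm)).sub hRm).aestronglyMeasurable
  have hLint : Integrable (fun y => Real.log (1 + R y)) γ := by
    refine (hEint.add hRint).congr (ae_of_all _ fun y => ?_)
    simp
  simp only [hS]
  refine ⟨hLint, ?_⟩
  have hE : |∫ y, Real.log (1 + R y) ∂γ - ∫ y, R y ∂γ| ≤ 2 * (Real.exp 3 + 1) * δ ^ 2 := by
    rw [← integral_sub hLint hRint]
    refine (abs_integral_le_integral_abs).trans ?_
    refine (integral_mono hEint.abs (hDint.const_mul 2) hdiff).trans ?_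
    rw [integral_const_mul, integral_const_mul, integral_finsetSum _ fun i _ => hI2 i]
    have : ∑ i ∈ s.erase i0, ∫ y, w i * (er σ c (x i) y ^ 2 + 1) ∂γ ≤
        ∑ i ∈ s.erase i0, w i * (Real.exp 3 + 1) := by
      refine Finset.sum_le_sum fun i hi => ?_
      rw [integral_const_mul, integral_add (er_sq_integral σ c (x i) m hσ0).1 (integrable_const _),
        (er_sq_integral σ c (x i) m hσ0).2]
      have hi' := Finset.mem_of_mem_erase hi
      refine mul_le_mul_of_nonneg_left ?_ (hwn i hi)
      simp only [integral_const, probReal_univ, smul_eq_mul, mul_one]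
      gcongr
      rw [div_le_iff₀ (by positivity)]
      have h1 := (abs_le.1 (hd i hi' m hm)).2
      have h2 := (abs_le.1 (hd i hi' (x i) (hx i hi'))).2
      nlinarith
    rw [← Finset.sum_mul, hwe] at this
    have h5 : (1 - w i0) * (Real.exp 3 + 1) ≤ δ * (Real.exp 3 + 1) := by gcongr
    have hδ' : 0 ≤ δ := hδ0.trans hδ
    calc _ ≤ 2 * (δ * (δ * (Real.exp 3 + 1))) := by gcongr; exact this.trans h5
      _ = _ := by ring
  have hF : |∫ y, R y ∂γ - (∑ i ∈ s, w i * x i - c) * (m - c) / σ ^ 2| ≤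
      16 * B ^ 4 * (δ / σ ^ 4) := by
    have e1 : ∫ y, R y ∂γ = ∑ i ∈ s.erase i0, w i * (Real.exp ((x i - c) * (m - c) / σ ^ 2) - 1) := by
      simp only [hR]
      rw [integral_finsetSum _ fun i _ => hI1 i]
      refine Finset.sum_congr rfl fun i hi => ?_
      rw [integral_const_mul, integral_sub (er_integral σ c (x i) m hσ0).1 (integrable_const _),
        (er_integral σ c (x i) m hσ0).2]
      simp
    have e2 : (∑ i ∈ s, w i * x i - c) * (m - c) / σ ^ 2 =
        ∑ i ∈ s.erase i0, w i * ((x i - c) * (m - c) / σ ^ 2) := by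
      have : ∑ i ∈ s, w i * x i - c = ∑ i ∈ s.erase i0, w i * (x i - c) := by
        rw [← Finset.add_sum_erase s _ hi0, hc]
        simp only [mul_sub, Finset.sum_sub_distrib, ← Finset.sum_mul, hwe]
        ring
      rw [this, Finset.sum_mul, Finset.sum_div]
      refine Finset.sum_congr rfl fun i hi => ?_
      ring
    rw [e1, e2, ← Finset.sum_sub_distrib]
    refine (Finset.abs_sum_le_sum_abs _ _).trans ?_
    have : ∀ i ∈ s.erase i0, |w i * (Real.exp ((x i - c) * (m - c) / σ ^ 2) - 1) -
        w i * ((x i - c) * (m - c) / σ ^ 2)| ≤ w i * (16 * B ^ 4 / σ ^ 4) := by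
      intro i hi
      have hi' := Finset.mem_of_mem_erase hi
      rw [← mul_sub, abs_mul, abs_of_nonneg (hwn i hi)]
      refine mul_le_mul_of_nonneg_left ?_ (hwn i hi)
      have h1 := hd i hi' m hm
      refine (Real.abs_exp_sub_one_sub_id_le ?_).trans ?_
      · rw [abs_div, abs_of_pos (by positivity : (0:ℝ) < σ ^ 2), div_le_one (by positivity)]
        exact h1.trans hσ2
      · rw [div_pow, ← pow_mul]
        gcongr
        rw [← sq_abs]
        calc _ ≤ ((2 * B) ^ 2) ^ 2 := by gcongr
          _ = _ := by ring
    refine (Finset.sum_le_sum this).trans ?_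
    rw [← Finset.sum_mul, hwe]
    calc _ ≤ δ * (16 * B ^ 4 / σ ^ 4) := by gcongr
      _ = _ := by ring
  calc _ ≤ |∫ y, Real.log (1 + R y) ∂γ - ∫ y, R y ∂γ| +
      |∫ y, R y ∂γ - (∑ i ∈ s, w i * x i - c) * (m - c) / σ ^ 2| := abs_sub_le _ _ _
    _ ≤ _ := by linarith

noncomputable def wt (N : ℕ) (q : ℝ) (J : Finset ℕ) : ℝ := q ^ J.card * (1 - q) ^ (N - J.card)

lemma wt_sum (N : ℕ) (q : ℝ) : ∑ J ∈ (Finset.range N).powerset, wt N q J = 1 := by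
  have := Finset.sum_pow_mul_eq_add_pow q (1 - q) (Finset.range N)
  simpa [wt] using this

lemma wt_nonneg (N : ℕ) (q : ℝ) (hq : q ∈ Set.Ioo (0 : ℝ) 1) (J : Finset ℕ) : 0 ≤ wt N q J := by
  have h1 := hq.1.le
  have h2 : 0 ≤ 1 - q := by linarith [hq.2]
  unfold wt; positivity

lemma wt_full (N : ℕ) (q : ℝ) : wt N q (Finset.range N) = q ^ N := by simp [wt]

lemma wt_succ_left (N : ℕ) (q : ℝ) (J : Finset ℕ) (hJ : J ∈ (Finset.range N).powerset) :
    wt (N + 1) q J = (1 - q) * wt N q J := by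
  have h : J.card ≤ N := by simpa using Finset.card_le_card (Finset.mem_powerset.1 hJ)
  unfold wt
  rw [Nat.sub_add_comm h, pow_succ]; ring

lemma wt_succ_right (N : ℕ) (q : ℝ) (J : Finset ℕ) (hJ : J ∈ (Finset.range N).powerset) :
    wt (N + 1) q (insert N J) = q * wt N q J := by
  have h : N ∉ J := fun h => by simpa using Finset.mem_powerset.1 hJ h
  unfold wt
  rw [Finset.card_insert_of_notMem h, Nat.add_sub_add_right, pow_succ]; ring

lemma wt_mean (N : ℕ) (q : ℝ) (g : ℕ → ℝ) :
    ∑ J ∈ (Finset.range N).powerset, wt N q J * sumFn g J = q * sumFn g (Finset.range N) := by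
  induction N with
  | zero => simp [sumFn]
  | succ N ih =>
    rw [Finset.range_add_one, Finset.sum_powerset_insert (by simp)]
    have h1 : ∑ J ∈ (Finset.range N).powerset, wt (N + 1) q J * sumFn g J =
        (1 - q) * (q * sumFn g (Finset.range N)) := by
      rw [← ih, Finset.mul_sum]
      refine Finset.sum_congr rfl fun J hJ => ?_
      rw [wt_succ_left N q J hJ]; ring
    have h2 : ∑ J ∈ (Finset.range N).powerset, wt (N + 1) q (insert N J) * sumFn g (insert N J) =
        q * (q * sumFn g (Finset.range N)) + q * g N := by
      rw [← ih, ← mul_one (q * g N), ← wt_sum N q, Finset.mul_sum, Finset.mul_sum,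
        ← Finset.sum_add_distrib]
      refine Finset.sum_congr rfl fun J hJ => ?_
      have h : N ∉ J := fun h => by simpa using Finset.mem_powerset.1 hJ h
      rw [wt_succ_right N q J hJ]
      simp only [sumFn, Finset.sum_insert h]; ring
    rw [h1, h2]
    simp only [sumFn]
    rw [Finset.sum_insert (by simp)]; ring

noncomputable def mix (N : ℕ) (σ q : ℝ) (h : Finset ℕ → ℝ) : Measure ℝ :=
  ∑ J ∈ (Finset.range N).powerset,
    ENNReal.ofReal (wt N q J) • gaussianReal (h J) (σ ^ 2).toNNReal

noncomputable def Sd (N : ℕ) (σ q : ℝ) (h : Finset ℕ → ℝ) (c y : ℝ) : ℝ :=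
  ∑ J ∈ (Finset.range N).powerset, wt N q J * er σ c (h J) y

lemma Sd_measurable (N : ℕ) (σ q : ℝ) (h : Finset ℕ → ℝ) (c : ℝ) :
    Measurable (Sd N σ q h c) := by
  have := fun J => er_measurable σ c (h J)
  unfold Sd
  fun_prop

lemma Sd_pos (N : ℕ) (σ q : ℝ) (hq : q ∈ Set.Ioo (0 : ℝ) 1) (h : Finset ℕ → ℝ) (c y : ℝ) :
    0 < Sd N σ q h c y := by
  refine Finset.sum_pos (fun J _ => ?_) ⟨∅, by simp⟩
  have h1 := hq.1
  have h2 : 0 < 1 - q := by linarith [hq.2]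
  have := er_pos σ c (h J) y
  unfold wt; positivity

lemma mix_density (N : ℕ) (σ q : ℝ) (hσ : 0 < σ) (hq : q ∈ Set.Ioo (0 : ℝ) 1)
    (h : Finset ℕ → ℝ) (c : ℝ) :
    mix N σ q h = (gaussianReal c (σ ^ 2).toNNReal).withDensity
      (fun y => ENNReal.ofReal (Sd N σ q h c y)) := by
  ext A hA
  rw [withDensity_apply _ hA]
  have e : ∀ y, ENNReal.ofReal (Sd N σ q h c y) = ∑ J ∈ (Finset.range N).powerset,
      ENNReal.ofReal (wt N q J) * ENNReal.ofReal (er σ c (h J) y) := by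
    intro y
    unfold Sd
    rw [ENNReal.ofReal_sum_of_nonneg fun J _ =>
      mul_nonneg (wt_nonneg N q hq J) (er_pos σ c (h J) y).le]
    refine Finset.sum_congr rfl fun J _ => ?_
    rw [ENNReal.ofReal_mul (wt_nonneg N q hq J)]
  simp only [e]
  rw [lintegral_finsetSum _ fun J _ => ((er_measurable σ c (h J)).ennreal_ofReal.const_mul _)]
  unfold mix
  rw [Measure.finsetSum_apply]
  refine Finset.sum_congr rfl fun J _ => ?_
  rw [Measure.smul_apply, gauss_er σ c (h J) hσ, withDensity_apply _ hA,
    lintegral_const_mul _ (er_measurable σ c (h J)).ennreal_ofReal]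
  rfl

lemma mix_integral (N : ℕ) (σ q : ℝ) (hq : q ∈ Set.Ioo (0 : ℝ) 1) (h : Finset ℕ → ℝ) (f : ℝ → ℝ)
    (hf : ∀ J ∈ (Finset.range N).powerset, Integrable f (gaussianReal (h J) (σ ^ 2).toNNReal)) :
    Integrable f (mix N σ q h) ∧ ∫ y, f y ∂(mix N σ q h) = ∑ J ∈ (Finset.range N).powerset,
      wt N q J * ∫ y, f y ∂(gaussianReal (h J) (σ ^ 2).toNNReal) := by
  have hi : ∀ J ∈ (Finset.range N).powerset, Integrable f
      (ENNReal.ofReal (wt N q J) • gaussianReal (h J) (σ ^ 2).toNNReal) := fun J hJ =>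
    (hf J hJ).smul_measure ENNReal.ofReal_ne_top
  refine ⟨integrable_finsetSum_measure.2 hi, ?_⟩
  unfold mix
  rw [integral_finsetSum_measure hi]
  refine Finset.sum_congr rfl fun J _ => ?_
  rw [integral_smul_measure, ENNReal.toReal_ofReal (wt_nonneg N q hq J), smul_eq_mul]

lemma lin_integral (M : ℕ) (σ q α β : ℝ) (hq : q ∈ Set.Ioo (0 : ℝ) 1) (g : ℕ → ℝ) :
    Integrable (fun y => α * y + β) (mix M σ q (sumFn g)) ∧
    ∫ y, (α * y + β) ∂(mix M σ q (sumFn g)) = α * (q * sumFn g (Finset.range M)) + β := by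
  have hid : ∀ m, Integrable (fun y : ℝ => y) (gaussianReal m (σ ^ 2).toNNReal) := fun m =>
    (memLp_id_gaussianReal 1).integrable (by simp)
  have h := mix_integral M σ q hq (sumFn g) (fun y => α * y + β)
    (fun J _ => ((hid _).const_mul α).add (integrable_const _))
  refine ⟨h.1, h.2.trans ?_⟩
  have e : ∀ m, ∫ y, (α * y + β) ∂(gaussianReal m (σ ^ 2).toNNReal) = α * m + β := by
    intro m
    rw [integral_add ((hid _).const_mul α) (integrable_const _), integral_const_mul,
      integral_id_gaussianReal]
    simp
  simp only [e, mul_add, Finset.sum_add_distrib]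
  rw [← wt_mean, Finset.mul_sum, ← Finset.sum_mul, wt_sum, one_mul]
  congr 1
  refine Finset.sum_congr rfl fun J _ => ?_
  ring

lemma mix_key (n N M : ℕ) (hN : N ≤ n + 1) (hM : M ≤ n + 1) (σ q B : ℝ)
    (hq : q ∈ Set.Ioo (0 : ℝ) 1) (g : ℕ → ℝ) (hB : ∑ j ∈ Finset.range (n + 1), |g j| = B)
    (hσ : 2 * B + 1 ≤ σ) (ht : 1 - q ≤ 1 / (2 * (n + 1))) :
    Integrable (fun y => Real.log (Sd N σ q (sumFn g) (sumFn g (Finset.range N)) y))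
      (mix M σ q (sumFn g)) ∧
    |∫ y, Real.log (Sd N σ q (sumFn g) (sumFn g (Finset.range N)) y) ∂(mix M σ q (sumFn g)) -
      (q * sumFn g (Finset.range N) - sumFn g (Finset.range N)) *
        (q * sumFn g (Finset.range M) - sumFn g (Finset.range N)) / σ ^ 2| ≤
      16 * B ^ 4 * (((n + 1) * (1 - q)) / σ ^ 4) +
        2 * (Real.exp 3 + 1) * ((n + 1) * (1 - q)) ^ 2 := by
  have hJB : ∀ K ≤ n + 1, ∀ J ∈ (Finset.range K).powerset, |sumFn g J| ≤ B := by
    intro K hK J hJ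
    rw [← hB]
    refine (Finset.abs_sum_le_sum_abs _ _).trans ?_
    refine Finset.sum_le_sum_of_subset_of_nonneg ?_ (fun _ _ _ => abs_nonneg _)
    exact (Finset.mem_powerset.1 hJ).trans (Finset.range_subset_range.2 hK)
  have hfull : ∀ K, Finset.range K ∈ (Finset.range K).powerset := fun K => by simp
  have hber : 1 - q ^ N ≤ (n + 1) * (1 - q) := by
    have := one_add_mul_le_pow (a := q - 1) (by linarith [hq.1]) N
    rw [add_sub_cancel] at this
    have h2 : (N : ℝ) ≤ n + 1 := by exact_mod_cast hN
    nlinarith [hq.2]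
  have hhalf : (n + 1) * (1 - q) ≤ 1 / 2 := by
    rw [le_div_iff₀ (by positivity)] at ht
    linarith
  have hk := fun J (hJ : J ∈ (Finset.range M).powerset) =>
    key (Finset.range N).powerset (Finset.range N) (hfull N) (wt N q) (sumFn g) B
      ((n + 1) * (1 - q)) σ (sumFn g J) (sumFn g (Finset.range N))
      (fun i _ => wt_nonneg N q hq i) (wt_sum N q) (by rw [wt_full]; linarith)
      (by rw [wt_full]; exact hber) (hJB N hN) (hJB M hM J hJ) rfl hσ
  have hi := mix_integral M σ q hq (sumFn g) _ (fun J hJ => (hk J hJ).1)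
  refine ⟨hi.1, ?_⟩
  simp only [Sd]
  rw [hi.2]
  set c := sumFn g (Finset.range N) with hc
  rw [wt_mean N, ← hc] at hk
  have e : (q * c - c) * (q * sumFn g (Finset.range M) - c) / σ ^ 2 =
      ∑ J ∈ (Finset.range M).powerset, wt M q J * ((q * c - c) * (sumFn g J - c) / σ ^ 2) := by
    have h1 : q * sumFn g (Finset.range M) - c =
        ∑ J ∈ (Finset.range M).powerset, wt M q J * (sumFn g J - c) := by
      simp only [mul_sub, Finset.sum_sub_distrib, ← Finset.sum_mul, wt_mean, wt_sum, one_mul]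
    rw [h1, Finset.mul_sum, Finset.sum_div]
    refine Finset.sum_congr rfl fun J _ => ?_
    ring
  rw [e, ← Finset.sum_sub_distrib]
  refine (Finset.abs_sum_le_sum_abs _ _).trans ?_
  generalize hW : 16 * B ^ 4 * (((n + 1) * (1 - q)) / σ ^ 4) +
        2 * (Real.exp 3 + 1) * ((n + 1) * (1 - q)) ^ 2 = W at hk ⊢
  have hW1 : W = ∑ J ∈ (Finset.range M).powerset, wt M q J * W := by
    rw [← Finset.sum_mul, wt_sum, one_mul]
  rw [hW1]
  refine Finset.sum_le_sum fun J hJ => ?_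
  rw [← mul_sub, abs_mul, abs_of_nonneg (wt_nonneg M q hq J)]
  exact mul_le_mul_of_nonneg_left (hk J hJ).2 (wt_nonneg M q hq J)

lemma loss_ae (n : ℕ) (σ q : ℝ) (hσ : 0 < σ) (hq : q ∈ Set.Ioo (0 : ℝ) 1) (g : ℕ → ℝ) (M : ℕ) :
    privacyLoss n σ q (sumFn g) =ᵐ[mix M σ q (sumFn g)] fun y =>
      (g n / σ ^ 2 * y + (- g n * sumFn g (Finset.range n) / σ ^ 2 - g n ^ 2 / (2 * σ ^ 2))) +
      Real.log (Sd (n + 1) σ q (sumFn g) (sumFn g (Finset.range (n + 1))) y) -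
      Real.log (Sd n σ q (sumFn g) (sumFn g (Finset.range n)) y) := by
  set h := sumFn g
  set c := h (Finset.range n) with hc
  set c' := h (Finset.range (n + 1)) with hc'
  have hcc : c' = c + g n := by simp only [hc, hc', h, sumFn, Finset.sum_range_succ]
  set G := gaussianReal c (σ ^ 2).toNNReal
  have hP : subsampledP n σ q h = G.withDensity
      (fun y => ENNReal.ofReal (Sd (n + 1) σ q h c y)) := mix_density (n + 1) σ q hσ hq h c
  have hQ : subsampledQ n σ q h = G.withDensity
      (fun y => ENNReal.ofReal (Sd n σ q h c y)) := mix_density n σ q hσ hq h c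
  have hmP := Sd_measurable (n + 1) σ q h c
  have hmQ := Sd_measurable n σ q h c
  have hmD : Measurable (fun y => Sd (n + 1) σ q h c y / Sd n σ q h c y) := hmP.div hmQ
  have hPQ : subsampledP n σ q h = (subsampledQ n σ q h).withDensity
      (fun y => ENNReal.ofReal (Sd (n + 1) σ q h c y / Sd n σ q h c y)) := by
    rw [hP, hQ, ← withDensity_mul _ hmQ.ennreal_ofReal hmD.ennreal_ofReal]
    congr 1
    ext y
    have := Sd_pos n σ q hq h c y
    rw [Pi.mul_apply, ← ENNReal.ofReal_mul this.le, mul_div_cancel₀ _ this.ne']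
  have hGQ : G ≪ subsampledQ n σ q h := by
    rw [hQ]
    refine withDensity_absolutelyContinuous' hmQ.ennreal_ofReal.aemeasurable (ae_of_all _ fun y => ?_)
    have := Sd_pos n σ q hq h c y
    simpa using this
  have hMG : mix M σ q h ≪ G := by
    rw [mix_density M σ q hσ hq h c]
    exact withDensity_absolutelyContinuous _ _
  have : SigmaFinite (subsampledQ n σ q h) := by
    rw [hQ]
    exact SigmaFinite.withDensity_ofReal _
  have hr := Measure.rnDeriv_withDensity (subsampledQ n σ q h) hmD.ennreal_ofReal
  rw [← hPQ] at hr
  filter_upwards [(hMG.trans hGQ).ae_eq hr] with y hy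
  have p1 := Sd_pos n σ q hq h c y
  have p2 := Sd_pos (n + 1) σ q hq h c y
  have p3 := Sd_pos (n + 1) σ q hq h c' y
  unfold privacyLoss
  rw [hy, ENNReal.toReal_ofReal (by positivity), Real.log_div p2.ne' p1.ne']
  have e : Sd (n + 1) σ q h c y = er σ c c' y * Sd (n + 1) σ q h c' y := by
    unfold Sd
    rw [Finset.mul_sum]
    refine Finset.sum_congr rfl fun J _ => ?_
    rw [er_mul σ c c' (h J) y hσ]; ring
  rw [e, Real.log_mul (er_pos _ _ _ _).ne' p3.ne']
  unfold er
  rw [Real.log_exp, hcc]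
  ring

lemma loss_integral (n : ℕ) (σ q B : ℝ) (hq : q ∈ Set.Ioo (0 : ℝ) 1) (g : ℕ → ℝ) (M : ℕ)
    (hM : M ≤ n + 1) (hB : ∑ j ∈ Finset.range (n + 1), |g j| = B)
    (hσ : 2 * B + 1 ≤ σ) (ht : 1 - q ≤ 1 / (2 * (n + 1))) :
    |∫ y, privacyLoss n σ q (sumFn g) y ∂(mix M σ q (sumFn g)) -
      ((g n / σ ^ 2 * (q * sumFn g (Finset.range M)) +
        (- g n * sumFn g (Finset.range n) / σ ^ 2 - g n ^ 2 / (2 * σ ^ 2))) +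
      (q * sumFn g (Finset.range (n + 1)) - sumFn g (Finset.range (n + 1))) *
        (q * sumFn g (Finset.range M) - sumFn g (Finset.range (n + 1))) / σ ^ 2 -
      (q * sumFn g (Finset.range n) - sumFn g (Finset.range n)) *
        (q * sumFn g (Finset.range M) - sumFn g (Finset.range n)) / σ ^ 2)| ≤
      2 * (16 * B ^ 4 * (((n + 1) * (1 - q)) / σ ^ 4) +
        2 * (Real.exp 3 + 1) * ((n + 1) * (1 - q)) ^ 2) := by
  have hB0 : 0 ≤ B := hB ▸ Finset.sum_nonneg fun _ _ => abs_nonneg _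
  have h1 := mix_key n (n + 1) M le_rfl hM σ q B hq g hB hσ ht
  have h2 := mix_key n n M (Nat.le_succ n) hM σ q B hq g hB hσ ht
  have h3 := lin_integral M σ q (g n / σ ^ 2)
    (- g n * sumFn g (Finset.range n) / σ ^ 2 - g n ^ 2 / (2 * σ ^ 2)) hq g
  have h4 : Integrable (fun y => (g n / σ ^ 2 * y +
      (- g n * sumFn g (Finset.range n) / σ ^ 2 - g n ^ 2 / (2 * σ ^ 2))) +
      Real.log (Sd (n + 1) σ q (sumFn g) (sumFn g (Finset.range (n + 1))) y))
      (mix M σ q (sumFn g)) := h3.1.add h1.1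
  rw [integral_congr_ae (loss_ae n σ q (by linarith) hq g M),
    integral_sub h4 h2.1, integral_add h3.1 h1.1, h3.2]
  have k1 := abs_le.1 h1.2
  have k2 := abs_le.1 h2.2
  rw [abs_le]
  constructor <;> linarith [k1.1, k1.2, k2.1, k2.2]

lemma fin_bound1 (a H : ℝ) : |-(1 / 2) * a ^ 2 + (H + a) ^ 2 - H * (H + a)| ≤
    4 * (a ^ 2 + H ^ 2 + (H + a) ^ 2) := by
  rw [abs_le]; constructor <;> nlinarith [sq_nonneg (H + (H + a)), sq_nonneg a, sq_nonneg H, sq_nonneg (H + a)]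

lemma fin_bound2 (a H : ℝ) : |1 / 2 * a ^ 2 + (H + a) * H - H ^ 2| ≤
    4 * (a ^ 2 + H ^ 2 + (H + a) ^ 2) := by
  rw [abs_le]; constructor <;> nlinarith [sq_nonneg (H + (H + a)), sq_nonneg a, sq_nonneg H, sq_nonneg (H + a)]

/-- **Large sampling-rate / large noise approximation of the mean privacy loss of the
Poisson-subsampled Gaussian mechanism.**  With `h(J) = Σ_{j∈J} g j` and `μ = |g n|`, in
the joint limit `q̂ = 1 − q → 0`, `σ → ∞`:
`E_{P_{q,σ}} L_{q,σ} = ½ q² μ²/σ² + q̂·O(1/σ⁴) + O(q̂²)` and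
`E_{Q_{q,σ}} L_{q,σ} = −½ q² μ²/σ² + q̂·O(1/σ⁴) + O(q̂²)`. -/
theorem subsampledGaussian_mean_privacyLoss_large_q
    (n : ℕ) (g : ℕ → ℝ) :
    ∃ C > (0 : ℝ), ∃ ε ∈ Set.Ioo (0 : ℝ) 1, ∃ σ₀ > (0 : ℝ),
      ∀ q ∈ Set.Ioo (0 : ℝ) 1, 1 - q ≤ ε → ∀ σ : ℝ, σ₀ ≤ σ →
        |(∫ y, privacyLoss n σ q (sumFn g) y ∂(subsampledP n σ q (sumFn g))) -
            1 / 2 * q ^ 2 * (g n) ^ 2 / σ ^ 2|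
          ≤ C * ((1 - q) / σ ^ 4 + (1 - q) ^ 2) ∧
        |(∫ y, privacyLoss n σ q (sumFn g) y ∂(subsampledQ n σ q (sumFn g))) +
            1 / 2 * q ^ 2 * (g n) ^ 2 / σ ^ 2|
          ≤ C * ((1 - q) / σ ^ 4 + (1 - q) ^ 2) := by
  set B := ∑ j ∈ Finset.range (n + 1), |g j| with hB
  have hB0 : 0 ≤ B := Finset.sum_nonneg fun _ _ => abs_nonneg _
  set H := sumFn g (Finset.range n) with hH
  set a := g n with ha
  have hHa : sumFn g (Finset.range (n + 1)) = H + a := by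
    simp only [hH, ha, sumFn, Finset.sum_range_succ]
  set D : ℝ := n + 1 with hD
  have hD0 : 0 < D := by positivity
  set E : ℝ := a ^ 2 + H ^ 2 + (H + a) ^ 2 with hE
  have hE0 : 0 ≤ E := by positivity
  refine ⟨2 * (16 * B ^ 4 * D) + 2 * (2 * (Real.exp 3 + 1) * D ^ 2) + 4 * E + 1, by positivity,
    1 / (2 * D), ⟨by positivity, ?_⟩, 2 * B + 1, by positivity, ?_⟩
  · rw [div_lt_one (by positivity)]
    have : (0 : ℝ) ≤ n := by positivity
    linarith
  intro q hq ht σ hσ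
  have hσ1 : 1 ≤ σ := by linarith
  have hσp : 0 < σ := by linarith
  have ht0 : 0 ≤ 1 - q := by linarith [hq.2]
  have hs2 : (σ ^ 2)⁻¹ ≤ 1 := inv_le_one_of_one_le₀ (one_le_pow₀ hσ1)
  have hs0 : 0 ≤ (σ ^ 2)⁻¹ := by positivity
  have hPk := loss_integral n σ q B hq g (n + 1) le_rfl hB.symm hσ ht
  have hQk := loss_integral n σ q B hq g n (Nat.le_succ n) hB.symm hσ ht
  rw [hHa] at hPk hQk
  change |∫ y, privacyLoss n σ q (sumFn g) y ∂(subsampledP n σ q (sumFn g)) - _| ≤ _ at hPk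
  change |∫ y, privacyLoss n σ q (sumFn g) y ∂(subsampledQ n σ q (sumFn g)) - _| ≤ _ at hQk
  have hmain : ∀ I T Z : ℝ, |I - Z| ≤ 2 * (16 * B ^ 4 * ((D * (1 - q)) / σ ^ 4) +
        2 * (Real.exp 3 + 1) * (D * (1 - q)) ^ 2) →
      (∃ K, Z - T = (1 - q) ^ 2 * (K * (σ ^ 2)⁻¹) ∧ |K| ≤ 4 * E) →
      |I - T| ≤ (2 * (16 * B ^ 4 * D) + 2 * (2 * (Real.exp 3 + 1) * D ^ 2) + 4 * E + 1) *
        ((1 - q) / σ ^ 4 + (1 - q) ^ 2) := by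
    rintro I T Z h1 ⟨K, hK, hKE⟩
    have h2 : |Z - T| ≤ (1 - q) ^ 2 * (4 * E) := by
      rw [hK, abs_mul, abs_mul, abs_of_nonneg hs0, abs_of_nonneg (sq_nonneg (1 - q))]
      refine mul_le_mul_of_nonneg_left ?_ (sq_nonneg _)
      calc |K| * (σ ^ 2)⁻¹ ≤ |K| * 1 := by gcongr
        _ ≤ _ := by linarith
    have h3 := abs_sub_le I Z T
    have hu : 0 ≤ (1 - q) / σ ^ 4 := by positivity
    have hw : 0 ≤ (1 - q) ^ 2 := by positivity
    have ex := Real.exp_pos 3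
    have e1 : (D * (1 - q)) / σ ^ 4 = D * ((1 - q) / σ ^ 4) := by ring
    rw [e1] at h1
    set u := (1 - q) / σ ^ 4
    set w := (1 - q) ^ 2
    have e2 : (D * (1 - q)) ^ 2 = D ^ 2 * w := by ring
    rw [e2] at h1
    have i1 : 0 ≤ (16 * B ^ 4 * D) * w := by positivity
    have i2 : 0 ≤ (Real.exp 3 + 1) * D ^ 2 * u := by positivity
    have i3 : 0 ≤ E * u := by positivity
    nlinarith
  constructor
  · refine hmain _ _ _ hPk ⟨-(1 / 2) * a ^ 2 + (H + a) ^ 2 - H * (H + a), ?_, ?_⟩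
    · field_simp
      ring
    · exact fin_bound1 a H
  · have := hmain _ (-(1 / 2 * q ^ 2 * a ^ 2 / σ ^ 2)) _ hQk
      ⟨1 / 2 * a ^ 2 + (H + a) * H - H ^ 2, ?_, ?_⟩
    · simpa using this
    · field_simp
      ring
    · exact fin_bound2 a H
end

section
/- There exist constants C > 0, ε ∈ (0,1) and σ₀ > 0, depending on n and g₀,…,g_n, such that for all q ∈ (0,1) with q̂ = 1 − q ≤ ε and all σ ≥ σ₀: |Var_{P_{q,σ}}[L_{q,σ}] − q²·μ²/σ²| ≤ C·(q̂/σ⁴ + q̂²) and |Var_{Q_{q,σ}}[L_{q,σ}] − q²·μ²/σ²| ≤ C·(q̂/σ⁴ + q̂²). That is, in the joint limit q̂ → 0 and σ → ∞, the variance of the privacy loss under each of P and Q is q²μ²/σ² + q̂·O(1/σ⁴) + O(q̂²). -/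
open MeasureTheory ProbabilityTheory

/-- The variance `Var_μ[f] = E_μ[f²] − (E_μ[f])²` of a function against a measure. -/
noncomputable def varAgainst (μ : Measure ℝ) (f : ℝ → ℝ) : ℝ :=
  (∫ y, f y ^ 2 ∂μ) - (∫ y, f y ∂μ) ^ 2


lemma log_aux {k r : ℝ} (hk : 0 < k) (hr : 1 / k ≤ r) : |Real.log r - (r - 1)| ≤ k * (r - 1) ^ 2 := by
  have hr0 : 0 < r := lt_of_lt_of_le (by positivity) hr
  have h1 := Real.log_le_sub_one_of_pos hr0
  have h2 := Real.one_sub_inv_le_log_of_pos hr0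
  have h3 : r⁻¹ ≤ k := by
    rw [inv_le_comm₀ hr0 hk]; simpa using hr
  have h4 : (r - 1) - (1 - r⁻¹) = r⁻¹ * (r - 1) ^ 2 := by field_simp
  have h5 : r⁻¹ * (r - 1) ^ 2 ≤ k * (r - 1) ^ 2 := by gcongr
  rw [abs_le]; constructor <;> nlinarith [sq_nonneg (r - 1)]

lemma exp_aux1 (u : ℝ) : |Real.exp u - 1| ≤ |u| * Real.exp |u| := by
  have := Complex.norm_exp_sub_sum_le_norm_mul_exp (u : ℂ) 1
  simp only [Finset.sum_range_one, pow_zero, Nat.factorial_zero, Nat.cast_one, div_one, pow_one] at this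
  rw [← Complex.ofReal_exp, ← Complex.ofReal_one, ← Complex.ofReal_sub, Complex.norm_real, Complex.norm_real] at this
  simpa using this

lemma exp_aux3 (u : ℝ) : |Real.exp u - 1 - u - u ^ 2 / 2| ≤ |u| ^ 3 * Real.exp |u| := by
  have := Complex.norm_exp_sub_sum_le_norm_mul_exp (u : ℂ) 3
  simp only [Finset.sum_range_succ, Finset.sum_range_zero] at this
  have h : (Complex.exp (u:ℂ) - (0 + (u:ℂ) ^ 0 / (Nat.factorial 0 : ℕ) + (u:ℂ) ^ 1 / (Nat.factorial 1 : ℕ) + (u:ℂ) ^ 2 / (Nat.factorial 2 : ℕ))) = ((Real.exp u - 1 - u - u ^ 2 / 2 : ℝ) : ℂ) := by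
    push_cast; simp [Nat.factorial]; ring
  rw [h, Complex.norm_real, Complex.norm_real] at this
  simpa using this

noncomputable def TT (t : ℝ) : ℝ := Real.exp (1 + |t|)

lemma TT_ge (t : ℝ) : 1 + |t| ≤ TT t := by
  have := Real.add_one_le_exp (1 + |t|)
  unfold TT; linarith

lemma one_le_TT (t : ℝ) : 1 ≤ TT t := by
  have := TT_ge t; have := abs_nonneg t; linarith

lemma ptw_E {s y t : ℝ} (hs0 : 0 ≤ s) (hs1 : s ≤ 1) (hy : |y| ≤ s) :
    |y * t - y ^ 2 / 2| ≤ s * (1 + |t|) ∧ Real.exp |y * t - y ^ 2 / 2| ≤ TT t ∧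
      |Real.exp (y * t - y ^ 2 / 2) - 1| ≤ s * TT t ^ 2 := by
  have h1 : |y * t - y ^ 2 / 2| ≤ s * (1 + |t|) := by
    have ha : |y * t - y ^ 2 / 2| ≤ |y * t| + |y ^ 2 / 2| := abs_sub _ _
    have hb : |y ^ 2 / 2| = |y| * |y| / 2 := by rw [abs_div, abs_pow]; norm_num; ring
    rw [abs_mul, hb] at ha
    nlinarith [abs_nonneg y, abs_nonneg t, mul_le_mul_of_nonneg_right hy (abs_nonneg t), mul_le_mul hy (hy.trans hs1) (abs_nonneg y) hs0]
  have h2 : Real.exp |y * t - y ^ 2 / 2| ≤ TT t := by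
    unfold TT
    apply Real.exp_le_exp.2
    nlinarith [abs_nonneg t]
  refine ⟨h1, h2, (exp_aux1 _).trans ?_⟩
  calc _ ≤ (s * (1 + |t|)) * TT t := by gcongr
    _ ≤ (s * TT t) * TT t := by
      have h0 : 0 ≤ TT t := (Real.exp_pos _).le
      have := TT_ge t
      gcongr
    _ = _ := by ring

set_option maxHeartbeats 1000000 in
lemma ptw {ι : Type*} [DecidableEq ι] (S : Finset ι) (w y : ι → ℝ) (i0 : ι) (hi0 : i0 ∈ S)
    (hy0 : y i0 = 0) (hw0 : ∀ i ∈ S, 0 ≤ w i) (hw1 : ∑ i ∈ S, w i = 1) (hwf : 1 / 2 ≤ w i0)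
    (δ s γ t : ℝ) (hwd : ∀ i ∈ S, i ≠ i0 → w i ≤ δ) (hδ0 : 0 < δ) (hδ : δ ≤ 1 / 2)
    (hs0 : 0 ≤ s) (hs1 : s ≤ 1) (hy : ∀ i ∈ S, |y i| ≤ s) (hγ : |γ| ≤ s) :
    |Real.log (δ + (1 - δ) * Real.exp (γ * t - γ ^ 2 / 2) *
        ((∑ i ∈ S, w i * (Real.exp (y i * t - y i ^ 2 / 2) * Real.exp (-(y i * γ)))) /
          (∑ i ∈ S, w i * Real.exp (y i * t - y i ^ 2 / 2)))) -
      ((∑ i ∈ S, w i * (Real.exp (-(y i * γ)) - 1) - (1 - δ) * γ ^ 2 / 2) + (1 - δ) * γ * t +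
        δ * γ ^ 2 / 2 * t ^ 2)| ≤ 110 * (S.card : ℝ) ^ 2 * (δ * s ^ 3 + δ ^ 2) * TT t ^ 4 := by
  set N : ℝ := (S.card : ℝ) with hN
  have hN1 : 1 ≤ N := by
    rw [hN]; exact_mod_cast Finset.card_pos.2 ⟨i0, hi0⟩
  set T := TT t with hTdef
  have hT1 : 1 ≤ T := one_le_TT t
  have hTt : 1 + |t| ≤ T := TT_ge t
  have htT : |t| ≤ T := by linarith
  set E : ι → ℝ := fun i => Real.exp (y i * t - y i ^ 2 / 2) with hE
  set D : ι → ℝ := fun i => Real.exp (-(y i * γ)) with hD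
  have hEpos : ∀ i, 0 < E i := fun i => Real.exp_pos _
  have hE1 : ∀ i ∈ S, |E i - 1| ≤ s * T ^ 2 := fun i hi => (ptw_E hs0 hs1 (hy i hi)).2.2
  have hET : ∀ i ∈ S, E i ≤ T := fun i hi =>
    (Real.exp_le_exp.2 (le_abs_self _)).trans (ptw_E hs0 hs1 (hy i hi)).2.1
  have hyγ : ∀ i ∈ S, |-(y i * γ)| ≤ s ^ 2 := fun i hi => by
    rw [abs_neg, abs_mul, sq]; exact mul_le_mul (hy i hi) hγ (abs_nonneg _) hs0
  have hs2 : s ^ 2 ≤ 1 := pow_le_one₀ hs0 hs1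
  have hD1 : ∀ i ∈ S, |D i - 1| ≤ 2 * s ^ 2 := fun i hi =>
    (Real.abs_exp_sub_one_le ((hyγ i hi).trans hs2)).trans (by linarith [hyγ i hi])
  have hDl : ∀ i ∈ S, 1 / 3 ≤ D i := fun i hi => by
    have h1 : Real.exp (-1) ≤ D i := Real.exp_le_exp.2 (by linarith [(abs_le.1 (hyγ i hi)).1])
    have h2 : (1:ℝ) / 3 ≤ Real.exp (-1) := by
      rw [Real.exp_neg, ← one_div]
      exact one_div_le_one_div_of_le (Real.exp_pos 1) (by linarith [Real.exp_one_lt_d9])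
    linarith
  set F := ∑ i ∈ S, w i * E i with hF
  have hFl : 1 / 2 ≤ F := by
    have h1 : w i0 * E i0 ≤ F := Finset.single_le_sum (f := fun i => w i * E i)
      (fun i hi => mul_nonneg (hw0 i hi) (hEpos i).le) hi0
    have h2 : E i0 = 1 := by simp [hE, hy0]
    rw [h2] at h1; linarith
  have hF0 : 0 < F := by linarith
  have hF1 : |F - 1| ≤ s * T ^ 2 := by
    have h1 : F - 1 = ∑ i ∈ S, w i * (E i - 1) := by
      simp only [mul_sub, mul_one, Finset.sum_sub_distrib, hw1]; rfl
    rw [h1]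
    calc _ ≤ ∑ i ∈ S, |w i * (E i - 1)| := Finset.abs_sum_le_sum_abs _ _
      _ ≤ ∑ i ∈ S, w i * (s * T ^ 2) := by
        apply Finset.sum_le_sum
        intro i hi
        rw [abs_mul, abs_of_nonneg (hw0 i hi)]
        exact mul_le_mul_of_nonneg_left (hE1 i hi) (hw0 i hi)
      _ = s * T ^ 2 := by rw [← Finset.sum_mul, hw1, one_mul]
  -- generic sum bound
  have hgen : ∀ (X : ι → ℝ) (b : ℝ), 0 ≤ b → (∀ i ∈ S, |X i| ≤ b) →
      |∑ i ∈ S, w i * ((D i - 1) * X i)| ≤ N * (δ * (2 * s ^ 2 * b)) := by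
    intro X b hb hX
    calc _ ≤ ∑ i ∈ S, |w i * ((D i - 1) * X i)| := Finset.abs_sum_le_sum_abs _ _
      _ ≤ ∑ i ∈ S, δ * (2 * s ^ 2 * b) := by
        apply Finset.sum_le_sum
        intro i hi
        by_cases h : i = i0
        · have : D i = 1 := by simp [hD, h, hy0]
          rw [this]; simp; positivity
        · rw [abs_mul, abs_mul, abs_of_nonneg (hw0 i hi)]
          exact mul_le_mul (hwd i hi h) (mul_le_mul (hD1 i hi) (hX i hi) (abs_nonneg _) (by positivity))
            (by positivity) hδ0.le
      _ = _ := by rw [Finset.sum_const, nsmul_eq_mul]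
  set Fg := ∑ i ∈ S, w i * (E i * D i) with hFg
  set r := Fg / F with hr
  set c := ∑ i ∈ S, w i * (D i - 1) with hc
  have hr1 : r - 1 = (∑ i ∈ S, w i * ((D i - 1) * E i)) / F := by
    rw [hr, div_sub_one hF0.ne', hFg, hF, ← Finset.sum_sub_distrib]
    congr 1; apply Finset.sum_congr rfl; intros; ring
  have hr1b : |r - 1| ≤ 4 * N * δ * s ^ 2 * T := by
    rw [hr1, abs_div, abs_of_pos hF0, div_le_iff₀ hF0]
    have := hgen E T (by linarith) (fun i hi => by rw [abs_of_pos (hEpos i)]; exact hET i hi)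
    have h2 : 0 ≤ 4 * N * δ * s ^ 2 * T := by positivity
    have h3 := mul_le_mul_of_nonneg_left hFl h2
    refine this.trans (le_trans (le_of_eq ?_) h3)
    ring
  have hrc : |r - 1 - c| ≤ 8 * N * δ * s ^ 3 * T ^ 2 := by
    have h1 : r - 1 - c = (∑ i ∈ S, w i * ((D i - 1) * (E i - F))) / F := by
      have : ∑ i ∈ S, w i * ((D i - 1) * (E i - F)) = ∑ i ∈ S, w i * ((D i - 1) * E i) - c * F := by
        rw [hc, Finset.sum_mul, ← Finset.sum_sub_distrib]
        apply Finset.sum_congr rfl; intros; ring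
      rw [this, hr1, sub_div, mul_div_cancel_right₀ _ hF0.ne']
    rw [h1, abs_div, abs_of_pos hF0, div_le_iff₀ hF0]
    have := hgen (fun i => E i - F) (2 * s * T ^ 2) (by positivity) (fun i hi => by
      have h3 : E i - F = (E i - 1) - (F - 1) := by ring
      show |E i - F| ≤ _
      rw [h3]
      exact (abs_sub _ _).trans (by linarith [hE1 i hi]))
    have h2 : 0 ≤ 8 * N * δ * s ^ 3 * T ^ 2 := by positivity
    have h3 := mul_le_mul_of_nonneg_left hFl h2
    refine this.trans (le_trans (le_of_eq ?_) h3)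
    ring
  have hrl : 1 / 3 ≤ r := by
    rw [hr, le_div_iff₀ hF0, hF, hFg, Finset.mul_sum]
    apply Finset.sum_le_sum
    intro i hi
    have := mul_le_mul_of_nonneg_left (hDl i hi) (mul_nonneg (hw0 i hi) (hEpos i).le)
    refine le_trans (le_of_eq ?_) (this.trans (le_of_eq ?_)) <;> ring
  have hr0 : 0 < r := lt_of_lt_of_le (by norm_num) hrl
  have hrinv : r⁻¹ ≤ 3 := by
    rw [inv_le_comm₀ hr0 (by norm_num)]; exact le_trans (by norm_num) hrl
  have hlogr := log_aux (by norm_num : (0:ℝ) < 3) hrl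
  set L := γ * t - γ ^ 2 / 2 with hL
  obtain ⟨hLb, hLe, -⟩ := ptw_E (t := t) hs0 hs1 hγ
  rw [← hL] at hLb hLe
  have heL : Real.exp (-L) ≤ T := (Real.exp_le_exp.2 (neg_le_abs L)).trans hLe
  -- main decomposition
  set u := δ * (Real.exp (-L) * r⁻¹ - 1) with hu
  have hupos : 0 < Real.exp (-L) * r⁻¹ := by positivity
  have hu1' : -δ ≤ u := by
    have h := mul_nonneg hδ0.le hupos.le
    have h' : u = δ * (Real.exp (-L) * r⁻¹) - δ := by rw [hu]; ring
    rw [h']; exact by linarith only [h]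
  have hmain : Real.log (δ + (1 - δ) * Real.exp L * r) = L + Real.log r + Real.log (1 + u) := by
    have h1 : δ + (1 - δ) * Real.exp L * r = Real.exp L * r * (1 + u) := by
      rw [hu, Real.exp_neg]
      have := (Real.exp_pos L).ne'
      field_simp
      ring
    have hu1 : 0 < 1 + u := by linarith only [hu1', hδ]
    rw [h1, Real.log_mul (by positivity) hu1.ne', Real.log_mul (by positivity) hr0.ne', Real.log_exp]
  have hul : 1 / 2 ≤ 1 + u := by linarith only [hu1', hδ]
  have hub : |u| ≤ 4 * δ * T := by
    have h1 : 0 < Real.exp (-L) * r⁻¹ := by positivity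
    have h2 : Real.exp (-L) * r⁻¹ ≤ T * 3 := mul_le_mul heL hrinv (by positivity) (by linarith)
    rw [hu, abs_mul, abs_of_pos hδ0]
    have : |Real.exp (-L) * r⁻¹ - 1| ≤ 4 * T := by rw [abs_le]; constructor <;> linarith only [h1, h2, hT1]
    calc _ ≤ δ * (4 * T) := by gcongr
      _ = _ := by ring
  have hlogu := log_aux (by norm_num : (0:ℝ) < 2) hul
  have hlogu' : |Real.log (1 + u) - u| ≤ 32 * δ ^ 2 * T ^ 2 := by
    have h1 : (1 + u - 1) = u := by ring
    rw [h1] at hlogu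
    have h2 : u ^ 2 ≤ (4 * δ * T) ^ 2 := by rw [← sq_abs]; gcongr
    refine hlogu.trans ((mul_le_mul_of_nonneg_left h2 (by norm_num)).trans (le_of_eq ?_))
    ring
  have hlogr' : |Real.log r - (r - 1)| ≤ 48 * N ^ 2 * δ ^ 2 * T ^ 2 := by
    have h2 : (r - 1) ^ 2 ≤ (4 * N * δ * s ^ 2 * T) ^ 2 := by rw [← sq_abs]; gcongr
    have h3 : (4 * N * δ * s ^ 2 * T) ^ 2 = (16 * N ^ 2 * δ ^ 2 * T ^ 2) * (s ^ 2) ^ 2 := by ring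
    have h4 : (16 * N ^ 2 * δ ^ 2 * T ^ 2) * (s ^ 2) ^ 2 ≤ (16 * N ^ 2 * δ ^ 2 * T ^ 2) * 1 := by
      gcongr; exact pow_le_one₀ (by positivity) hs2
    linarith only [hlogr, h2, h3, h4]
  have hu2 : |u - δ * (Real.exp (-L) - 1)| ≤ 12 * N * δ ^ 2 * T ^ 2 := by
    have h1 : u - δ * (Real.exp (-L) - 1) = δ * (Real.exp (-L) * (r⁻¹ * -(r - 1))) := by
      rw [hu]; field_simp; ring
    rw [h1, abs_mul, abs_mul, abs_mul, abs_neg, abs_of_pos hδ0, abs_of_pos (Real.exp_pos _),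
      abs_of_pos (inv_pos.2 hr0)]
    calc _ ≤ δ * (T * (3 * (4 * N * δ * s ^ 2 * T))) := by gcongr
      _ = (12 * N * δ ^ 2 * T ^ 2) * s ^ 2 := by ring
      _ ≤ (12 * N * δ ^ 2 * T ^ 2) * 1 := by gcongr
      _ = _ := by ring
  have hLT : |L| ≤ s * T := hLb.trans (by gcongr)
  have he3 : |Real.exp (-L) - 1 + L - L ^ 2 / 2| ≤ s ^ 3 * T ^ 4 := by
    have := exp_aux3 (-L)
    rw [abs_neg] at this
    have h1 : Real.exp (-L) - 1 + L - L ^ 2 / 2 = Real.exp (-L) - 1 - -L - (-L) ^ 2 / 2 := by ring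
    rw [h1]
    refine this.trans ?_
    calc _ ≤ (s * T) ^ 3 * T := by gcongr
      _ = _ := by ring
  have hL2 : |L ^ 2 / 2 - γ ^ 2 * t ^ 2 / 2| ≤ s ^ 3 * T := by
    have h1 : L ^ 2 / 2 - γ ^ 2 * t ^ 2 / 2 = γ ^ 3 * (γ / 8 - t / 2) := by rw [hL]; ring
    rw [h1, abs_mul, abs_pow]
    have h2 : |γ / 8 - t / 2| ≤ T := by
      refine (abs_sub _ _).trans ?_
      rw [abs_div, abs_div]
      rw [abs_of_pos (by norm_num : (0:ℝ) < 8), abs_of_pos (by norm_num : (0:ℝ) < 2)]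
      linarith only [abs_nonneg t, abs_nonneg γ, hγ, hs1, hTt]
    gcongr
  rw [hmain]
  have hfin : L + Real.log r + Real.log (1 + u) - (c - (1 - δ) * γ ^ 2 / 2 + (1 - δ) * γ * t + δ * γ ^ 2 / 2 * t ^ 2)
      = (Real.log r - (r - 1)) + (r - 1 - c) + (Real.log (1 + u) - u) + (u - δ * (Real.exp (-L) - 1))
        + δ * (Real.exp (-L) - 1 + L - L ^ 2 / 2) + δ * (L ^ 2 / 2 - γ ^ 2 * t ^ 2 / 2) := by
    rw [hL]; ring
  rw [hfin]
  have hab : ∀ a b c d e f : ℝ, |a + b + c + d + δ * e + δ * f| ≤ |a| + |b| + |c| + |d| + δ * |e| + δ * |f| := by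
    intro a b c d e f
    have h1 : δ * |e| = |δ * e| := by rw [abs_mul, abs_of_pos hδ0]
    have h2 : δ * |f| = |δ * f| := by rw [abs_mul, abs_of_pos hδ0]
    rw [h1, h2]
    refine (abs_add_le _ _).trans (add_le_add_left ?_ _)
    refine (abs_add_le _ _).trans (add_le_add_left ?_ _)
    refine (abs_add_le _ _).trans (add_le_add_left ?_ _)
    refine (abs_add_le _ _).trans (add_le_add_left ?_ _)
    exact abs_add_le _ _
  refine (hab _ _ _ _ _ _).trans ?_
  have hNN : N ≤ N ^ 2 := le_self_pow₀ hN1 (by norm_num)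
  have hN2 : 1 ≤ N ^ 2 := one_le_pow₀ hN1
  have hT2 : T ^ 2 ≤ T ^ 4 := pow_le_pow_right₀ hT1 (by norm_num)
  have hT3 : T ≤ T ^ 4 := le_self_pow₀ hT1 (by norm_num)
  have e1 : 48 * N ^ 2 * δ ^ 2 * T ^ 2 ≤ 48 * N ^ 2 * δ ^ 2 * T ^ 4 := by gcongr
  have e2 : 8 * N * δ * s ^ 3 * T ^ 2 ≤ 8 * N ^ 2 * δ * s ^ 3 * T ^ 4 := by gcongr
  have e3 : 32 * δ ^ 2 * T ^ 2 ≤ 32 * (N ^ 2 * δ ^ 2) * T ^ 4 := by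
    gcongr; exact le_mul_of_one_le_left (sq_nonneg δ) hN2
  have e4 : 12 * N * δ ^ 2 * T ^ 2 ≤ 12 * N ^ 2 * δ ^ 2 * T ^ 4 := by gcongr
  have e5 : δ * (s ^ 3 * T ^ 4) ≤ N ^ 2 * (δ * (s ^ 3 * T ^ 4)) := le_mul_of_one_le_left (by positivity) hN2
  have e6 : δ * (s ^ 3 * T) ≤ N ^ 2 * (δ * (s ^ 3 * T ^ 4)) :=
    le_trans (by gcongr) e5
  have e7 : δ * |Real.exp (-L) - 1 + L - L ^ 2 / 2| ≤ δ * (s ^ 3 * T ^ 4) := by gcongr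
  have e8 : δ * |L ^ 2 / 2 - γ ^ 2 * t ^ 2 / 2| ≤ δ * (s ^ 3 * T) := by gcongr
  have e9 : 0 ≤ N ^ 2 * (δ * (s ^ 3 * T ^ 4)) := by positivity
  have e10 : 0 ≤ N ^ 2 * δ ^ 2 * T ^ 4 := by positivity
  linarith only [e1, e2, e3, e4, e5, e6, e7, e8, e9, e10, hlogr', hrc, hlogu', hu2]

set_option maxHeartbeats 1000000 in
lemma core_alg (C K B : ℝ) (hC : 1 ≤ C) (hK : 1 ≤ K) (hB : 1 ≤ B)
    (δ s α β m1 m2 m3 m4 r0 r1 r2 r3 : ℝ)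
    (hδ0 : 0 < δ) (hδ : δ ≤ 1 / 2) (hs0 : 0 ≤ s) (hs1 : s ≤ 1)
    (hα : |α| ≤ s) (hβ : |β| ≤ δ * s ^ 2) (hm1 : |m1| ≤ K * s) (hm2 : |m2| ≤ B) (hm3 : |m3| ≤ K * s)
    (hm4 : |m4| ≤ B) (hr0 : |r0| ≤ C * (δ * s ^ 3 + δ ^ 2) * B) (hr1 : |r1| ≤ C * (δ * s ^ 3 + δ ^ 2) * B)
    (hr2 : |r2| ≤ C * (δ * s ^ 3 + δ ^ 2) * B) (hr3 : |r3| ≤ (C * (δ * s ^ 3 + δ ^ 2)) ^ 2 * B)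
    (hv : |m2 - m1 ^ 2 - 1| ≤ K * δ * s ^ 2) :
    |α ^ 2 * (m2 - m1 ^ 2) + 2 * α * β * (m3 - m1 * m2) + 2 * α * (r1 - m1 * r0)
      + (β ^ 2 * (m4 - m2 ^ 2) + 2 * β * (r2 - m2 * r0) + r3 - r0 ^ 2) - α ^ 2|
      ≤ (50 * C ^ 2 * K * B ^ 2) * (δ * s ^ 4 + δ ^ 2) := by
  set e := δ * s ^ 3 + δ ^ 2 with he
  have he0 : 0 ≤ e := by positivity
  have hs3 : s ^ 3 ≤ 1 := pow_le_one₀ hs0 hs1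
  have hs2 : s ^ 2 ≤ 1 := pow_le_one₀ hs0 hs1
  have he2 : e ≤ 2 * δ := by rw [he]; nlinarith
  have hse : s * e ≤ δ * s ^ 4 + δ ^ 2 := by rw [he]; nlinarith [sq_nonneg δ]
  have hβ' : |β| ≤ δ := hβ.trans (by nlinarith)
  have hBB : B ≤ B ^ 2 := le_self_pow₀ hB (by norm_num)
  have a1 : |α ^ 2 * (m2 - m1 ^ 2 - 1)| ≤ K * (δ * s ^ 4) := by
    rw [abs_mul, abs_pow]
    calc _ ≤ s ^ 2 * (K * δ * s ^ 2) := by gcongr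
      _ = _ := by ring
  have a2 : |2 * α * β * (m3 - m1 * m2)| ≤ 4 * K * B * (δ * s ^ 4) := by
    have h : |m3 - m1 * m2| ≤ 2 * K * s * B := by
      refine (abs_sub _ _).trans ?_
      rw [abs_mul]
      calc _ ≤ K * s * 1 + K * s * B := by gcongr; linarith
        _ ≤ K * s * B + K * s * B := by gcongr
        _ = _ := by ring
    rw [abs_mul, abs_mul, abs_mul, abs_two]
    calc _ ≤ 2 * s * (δ * s ^ 2) * (2 * K * s * B) := by gcongr
      _ = _ := by ring
  have h3 : |r1 - m1 * r0| ≤ 2 * K * C * B * e := by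
    refine (abs_sub _ _).trans ?_
    rw [abs_mul]
    calc _ ≤ 1 * (C * e * B) + K * 1 * (C * e * B) := by
          rw [one_mul]
          gcongr
          exact hm1.trans (by gcongr)
      _ ≤ K * (C * e * B) + K * 1 * (C * e * B) := by gcongr
      _ = _ := by ring
  have a3 : |2 * α * (r1 - m1 * r0)| ≤ 4 * K * C * B * (δ * s ^ 4 + δ ^ 2) := by
    rw [abs_mul, abs_mul, abs_two]
    calc _ ≤ 2 * s * (2 * K * C * B * e) := by gcongr
      _ = 4 * K * C * B * (s * e) := by ring
      _ ≤ _ := by gcongr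
  have a4 : |β ^ 2 * (m4 - m2 ^ 2)| ≤ 2 * B ^ 2 * δ ^ 2 := by
    rw [abs_mul, abs_pow]
    have : |m4 - m2 ^ 2| ≤ 2 * B ^ 2 := by
      refine (abs_sub _ _).trans ?_
      rw [abs_pow]
      have : |m2| ^ 2 ≤ B ^ 2 := by gcongr
      linarith
    calc _ ≤ δ ^ 2 * (2 * B ^ 2) := by gcongr
      _ = _ := by ring
  have h5 : |r2 - m2 * r0| ≤ 4 * C * B ^ 2 * δ := by
    refine (abs_sub _ _).trans ?_
    rw [abs_mul]
    calc _ ≤ 1 * (C * e * B) + B * (C * e * B) := by rw [one_mul]; gcongr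
      _ ≤ B * (C * e * B) + B * (C * e * B) := by gcongr
      _ = 2 * C * B ^ 2 * e := by ring
      _ ≤ 2 * C * B ^ 2 * (2 * δ) := by gcongr
      _ = _ := by ring
  have a5 : |2 * β * (r2 - m2 * r0)| ≤ 8 * C * B ^ 2 * δ ^ 2 := by
    rw [abs_mul, abs_mul, abs_two]
    calc _ ≤ 2 * δ * (4 * C * B ^ 2 * δ) := by gcongr
      _ = _ := by ring
  have a6 : |r3| ≤ 4 * C ^ 2 * B ^ 2 * δ ^ 2 := by
    refine hr3.trans ?_
    calc _ ≤ (C * (2 * δ)) ^ 2 * B ^ 2 := by gcongr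
      _ = _ := by ring
  have a7 : |r0 ^ 2| ≤ 4 * C ^ 2 * B ^ 2 * δ ^ 2 := by
    rw [abs_pow]
    calc _ ≤ (C * (2 * δ) * B) ^ 2 := by gcongr; exact hr0.trans (by gcongr)
      _ = _ := by ring
  have hX : α ^ 2 * (m2 - m1 ^ 2) + 2 * α * β * (m3 - m1 * m2) + 2 * α * (r1 - m1 * r0)
      + (β ^ 2 * (m4 - m2 ^ 2) + 2 * β * (r2 - m2 * r0) + r3 - r0 ^ 2) - α ^ 2
      = α ^ 2 * (m2 - m1 ^ 2 - 1) + 2 * α * β * (m3 - m1 * m2) + 2 * α * (r1 - m1 * r0)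
      + β ^ 2 * (m4 - m2 ^ 2) + 2 * β * (r2 - m2 * r0) + r3 - r0 ^ 2 := by ring
  rw [hX]
  have hab : ∀ a b c d e f g : ℝ, |a + b + c + d + e + f - g| ≤ |a| + |b| + |c| + |d| + |e| + |f| + |g| := by
    intro a b c d e f g
    refine (abs_sub _ _).trans (add_le_add_left ?_ _)
    refine (abs_add_le _ _).trans (add_le_add_left ?_ _)
    refine (abs_add_le _ _).trans (add_le_add_left ?_ _)
    refine (abs_add_le _ _).trans (add_le_add_left ?_ _)
    refine (abs_add_le _ _).trans (add_le_add_left ?_ _)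
    exact abs_add_le _ _
  refine (hab _ _ _ _ _ _ _).trans ?_
  set Z := δ * s ^ 4 + δ ^ 2 with hZ
  have hZ0 : 0 ≤ Z := by positivity
  have z1 : δ * s ^ 4 ≤ Z := by rw [hZ]; linarith only [sq_nonneg δ]
  have z2 : δ ^ 2 ≤ Z := by rw [hZ]; have : 0 ≤ δ * s ^ 4 := by positivity
                            linarith
  have hC2 : C ≤ C ^ 2 := le_self_pow₀ hC (by norm_num)
  have hC1 : 1 ≤ C ^ 2 := one_le_pow₀ hC
  have hB2 : 1 ≤ B ^ 2 := one_le_pow₀ hB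
  have hKB : 0 ≤ K * B ^ 2 := by positivity
  have q1 : K ≤ C ^ 2 * K * B ^ 2 := by
    calc K = 1 * K * 1 := by ring
      _ ≤ _ := by gcongr
  have q2 : 4 * K * B ≤ 4 * (C ^ 2 * K * B ^ 2) := by
    calc 4 * K * B = 4 * (1 * K * B) := by ring
      _ ≤ _ := by gcongr
  have q3 : 4 * K * C * B ≤ 4 * (C ^ 2 * K * B ^ 2) := by
    calc 4 * K * C * B = 4 * (C * K * B) := by ring
      _ ≤ _ := by gcongr
  have q4 : 2 * B ^ 2 ≤ 2 * (C ^ 2 * K * B ^ 2) := by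
    calc 2 * B ^ 2 = 2 * (1 * 1 * B ^ 2) := by ring
      _ ≤ _ := by gcongr
  have q5 : 8 * C * B ^ 2 ≤ 8 * (C ^ 2 * K * B ^ 2) := by
    calc 8 * C * B ^ 2 = 8 * (C * 1 * B ^ 2) := by ring
      _ ≤ _ := by gcongr
  have q6 : 4 * C ^ 2 * B ^ 2 ≤ 4 * (C ^ 2 * K * B ^ 2) := by
    calc 4 * C ^ 2 * B ^ 2 = 4 * (C ^ 2 * 1 * B ^ 2) := by ring
      _ ≤ _ := by gcongr
  set W := C ^ 2 * K * B ^ 2 with hW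
  have hW0 : 0 ≤ W := by positivity
  have p1 := a1.trans (mul_le_mul q1 z1 (by positivity) hW0)
  have p2 := a2.trans (mul_le_mul q2 z1 (by positivity) (by positivity))
  have p3 := a3.trans (mul_le_mul_of_nonneg_right q3 hZ0)
  have p4 := a4.trans (mul_le_mul q4 z2 (by positivity) (by positivity))
  have p5 := a5.trans (mul_le_mul q5 z2 (by positivity) (by positivity))
  have p6 := a6.trans (mul_le_mul q6 z2 (by positivity) (by positivity))
  have p7 := a7.trans (mul_le_mul q6 z2 (by positivity) (by positivity))
  have : 50 * C ^ 2 * K * B ^ 2 * Z = 50 * (W * Z) := by rw [hW]; ring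
  rw [this]
  have : 0 ≤ W * Z := by positivity
  linarith only [this, p1, p2, p3, p4, p5, p6, p7]

lemma bd_int (ν : Measure ℝ) [IsProbabilityMeasure ν] (B : ℝ)
    (hI : Integrable (fun t => TT t ^ 8) ν) (hB : ∫ t, TT t ^ 8 ∂ν ≤ B) (f : ℝ → ℝ) (hf : Measurable f)
    (b : ℝ) (hb : 0 ≤ b) (k : ℕ) (hk : k ≤ 8) (hfb : ∀ t, |f t| ≤ b * TT t ^ k) :
    Integrable f ν ∧ |∫ t, f t ∂ν| ≤ b * B := by
  have hfb' : ∀ t, |f t| ≤ b * TT t ^ 8 := fun t => (hfb t).trans (by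
    have := pow_le_pow_right₀ (one_le_TT t) hk
    gcongr)
  have h1 : Integrable f ν := (hI.const_mul b).mono' hf.aestronglyMeasurable
    (Filter.Eventually.of_forall fun t => by simpa using hfb' t)
  refine ⟨h1, ?_⟩
  calc _ ≤ ∫ t, |f t| ∂ν := abs_integral_le_integral_abs
    _ ≤ ∫ t, b * TT t ^ 8 ∂ν := integral_mono h1.abs (hI.const_mul b) hfb'
    _ = b * ∫ t, TT t ^ 8 ∂ν := integral_const_mul _ _
    _ ≤ _ := by gcongr

set_option maxHeartbeats 1000000 in
lemma core (ν : Measure ℝ) [IsProbabilityMeasure ν] (C K B : ℝ) (hC : 1 ≤ C) (hK : 1 ≤ K) (hB1 : 1 ≤ B)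
    (hI : Integrable (fun t => TT t ^ 8) ν) (hB : ∫ t, TT t ^ 8 ∂ν ≤ B)
    (δ s γ c : ℝ) (hδ0 : 0 < δ) (hδ : δ ≤ 1 / 2) (hs0 : 0 ≤ s) (hs1 : s ≤ 1) (hγ : |γ| ≤ s)
    (hm1 : |∫ t, t ∂ν| ≤ K * s) (hm3 : |∫ t, t ^ 3 ∂ν| ≤ K * s)
    (hv : |(∫ t, t ^ 2 ∂ν) - (∫ t, t ∂ν) ^ 2 - 1| ≤ K * δ * s ^ 2)
    (f : ℝ → ℝ) (hf : Measurable f)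
    (hfb : ∀ t, |f t - (c + (1 - δ) * γ * t + δ * γ ^ 2 / 2 * t ^ 2)| ≤ C * (δ * s ^ 3 + δ ^ 2) * TT t ^ 4) :
    |varAgainst ν f - (1 - δ) ^ 2 * γ ^ 2| ≤ (50 * C ^ 2 * K * B ^ 2) * (δ * s ^ 4 + δ ^ 2) := by
  set α := (1 - δ) * γ with hα
  set β := δ * γ ^ 2 / 2 with hβ
  set R : ℝ → ℝ := fun t => f t - (c + α * t + β * t ^ 2) with hR
  have hRm : Measurable R := by fun_prop
  set b := C * (δ * s ^ 3 + δ ^ 2) with hb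
  have hb0 : 0 ≤ b := by positivity
  have hRb : ∀ t, |R t| ≤ b * TT t ^ 4 := hfb
  have htT : ∀ t, |t| ≤ TT t := fun t => by linarith [TT_ge t]
  have hT0 : ∀ t, 0 ≤ TT t := fun t => by linarith [one_le_TT t]
  have bi := bd_int ν B hI hB
  have hpow : ∀ k : ℕ, k ≤ 8 → Integrable (fun t : ℝ => t ^ k) ν ∧ |∫ t, t ^ k ∂ν| ≤ 1 * B := fun k hk =>
    bi (fun t => t ^ k) (by fun_prop) 1 zero_le_one k hk (fun t => by
      rw [abs_pow, one_mul]; exact pow_le_pow_left₀ (abs_nonneg _) (htT t) _)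
  obtain ⟨i1, -⟩ := hpow 1 (by norm_num)
  obtain ⟨i2, b2⟩ := hpow 2 (by norm_num)
  obtain ⟨i3, -⟩ := hpow 3 (by norm_num)
  obtain ⟨i4, b4⟩ := hpow 4 (by norm_num)
  simp only [pow_one] at i1
  rw [one_mul] at b2 b4
  obtain ⟨j0, c0⟩ := bi R hRm b hb0 4 (by norm_num) hRb
  obtain ⟨j1, c1⟩ := bi (fun t => t * R t) (by fun_prop) b hb0 5 (by norm_num) (fun t => by
    rw [abs_mul]
    calc _ ≤ TT t * (b * TT t ^ 4) := mul_le_mul (htT t) (hRb t) (abs_nonneg _) (hT0 t)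
      _ = _ := by ring)
  obtain ⟨j2, c2⟩ := bi (fun t => t ^ 2 * R t) (by fun_prop) b hb0 6 (by norm_num) (fun t => by
    rw [abs_mul, abs_pow]
    calc _ ≤ TT t ^ 2 * (b * TT t ^ 4) := mul_le_mul (pow_le_pow_left₀ (abs_nonneg _) (htT t) _) (hRb t) (abs_nonneg _) (by positivity)
      _ = _ := by ring)
  obtain ⟨j3, c3⟩ := bi (fun t => R t ^ 2) (by fun_prop) (b ^ 2) (by positivity) 8 (by norm_num) (fun t => by
    rw [abs_pow]
    calc _ ≤ (b * TT t ^ 4) ^ 2 := pow_le_pow_left₀ (abs_nonneg _) (hRb t) _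
      _ = _ := by ring)
  have hfe : ∀ t, f t = c + α * t + β * t ^ 2 + R t := fun t => by simp only [hR]; ring
  have hfe2 : ∀ t, f t ^ 2 = c ^ 2 + (2 * c * α) * t + (α ^ 2 + 2 * c * β) * t ^ 2 + (2 * α * β) * t ^ 3
      + β ^ 2 * t ^ 4 + (2 * c) * R t + (2 * α) * (t * R t) + (2 * β) * (t ^ 2 * R t) + R t ^ 2 := fun t => by
    rw [hfe t]; ring
  have hadd : ∀ (u v : ℝ → ℝ) (x y : ℝ), (Integrable u ν ∧ ∫ t, u t ∂ν = x) → (Integrable v ν ∧ ∫ t, v t ∂ν = y) →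
      (Integrable (fun t => u t + v t) ν ∧ ∫ t, (u t + v t) ∂ν = x + y) := by
    rintro u v x y ⟨h1, rfl⟩ ⟨h2, rfl⟩
    exact ⟨h1.add h2, integral_add h1 h2⟩
  have hmul : ∀ (a : ℝ) (u : ℝ → ℝ), Integrable u ν →
      (Integrable (fun t => a * u t) ν ∧ ∫ t, a * u t ∂ν = a * ∫ t, u t ∂ν) :=
    fun a u h => ⟨h.const_mul a, integral_const_mul _ _⟩
  have hcst : ∀ a : ℝ, (Integrable (fun _ : ℝ => a) ν ∧ ∫ _, a ∂ν = a) := fun a =>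
    ⟨integrable_const a, by simp⟩
  have I1 : ∫ t, f t ∂ν = c + α * (∫ t, t ∂ν) + β * (∫ t, t ^ 2 ∂ν) + ∫ t, R t ∂ν := by
    rw [funext hfe]
    exact (hadd _ _ _ _ (hadd _ _ _ _ (hadd _ _ _ _ (hcst c) (hmul α _ i1)) (hmul β _ i2)) ⟨j0, rfl⟩).2
  have I2 : ∫ t, f t ^ 2 ∂ν = c ^ 2 + (2 * c * α) * (∫ t, t ∂ν) + (α ^ 2 + 2 * c * β) * (∫ t, t ^ 2 ∂ν)
      + (2 * α * β) * (∫ t, t ^ 3 ∂ν)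
      + β ^ 2 * (∫ t, t ^ 4 ∂ν) + (2 * c) * (∫ t, R t ∂ν) + (2 * α) * (∫ t, t * R t ∂ν)
      + (2 * β) * (∫ t, t ^ 2 * R t ∂ν) + ∫ t, R t ^ 2 ∂ν := by
    rw [funext hfe2]
    exact (hadd _ _ _ _ (hadd _ _ _ _ (hadd _ _ _ _ (hadd _ _ _ _ (hadd _ _ _ _ (hadd _ _ _ _ (hadd _ _ _ _
      (hadd _ _ _ _ (hcst (c ^ 2)) (hmul _ _ i1)) (hmul _ _ i2)) (hmul _ _ i3)) (hmul _ _ i4)) (hmul _ _ j0))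
      (hmul _ _ j1)) (hmul _ _ j2)) ⟨j3, rfl⟩).2
  have hαb : |α| ≤ s := by
    rw [hα, abs_mul, abs_of_nonneg (by linarith : (0:ℝ) ≤ 1 - δ)]
    nlinarith [abs_nonneg γ]
  have hβb : |β| ≤ δ * s ^ 2 := by
    have : |γ| ^ 2 ≤ s ^ 2 := pow_le_pow_left₀ (abs_nonneg _) hγ _
    rw [sq_abs] at this
    rw [hβ, abs_of_nonneg (by positivity)]
    nlinarith [sq_nonneg γ]
  have := core_alg C K B hC hK hB1 δ s α β _ _ _ _ _ _ _ _ hδ0 hδ hs0 hs1 hαb hβb hm1 b2 hm3 b4 c0 c1 c2 c3 hv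
  unfold varAgainst
  rw [I1, I2]
  convert this using 2
  rw [hα]; ring

noncomputable def mixT {ι : Type*} (S : Finset ι) (w x : ι → ℝ) : Measure ℝ :=
  ∑ i ∈ S, ENNReal.ofReal (w i) • gaussianReal (x i) 1

lemma mixT_integral {ι : Type*} (S : Finset ι) (w x : ι → ℝ) (hw : ∀ i ∈ S, 0 ≤ w i) (f : ℝ → ℝ)
    (hf : ∀ i ∈ S, Integrable f (gaussianReal (x i) 1)) :
    Integrable f (mixT S w x) ∧ ∫ t, f t ∂(mixT S w x) = ∑ i ∈ S, w i * ∫ t, f t ∂(gaussianReal (x i) 1) := by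
  have h : ∀ i ∈ S, Integrable f (ENNReal.ofReal (w i) • gaussianReal (x i) 1) := fun i hi =>
    (hf i hi).smul_measure ENNReal.ofReal_ne_top
  constructor
  · exact integrable_finsetSum_measure.2 h
  · unfold mixT
    rw [integral_finsetSum_measure h]
    apply Finset.sum_congr rfl
    intro i hi
    rw [integral_smul_measure, ENNReal.toReal_ofReal (hw i hi), smul_eq_mul]

lemma mixT_prob {ι : Type*} (S : Finset ι) (w x : ι → ℝ) (hw : ∀ i ∈ S, 0 ≤ w i) (h1 : ∑ i ∈ S, w i = 1) :
    IsProbabilityMeasure (mixT S w x) := by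
  constructor
  unfold mixT
  rw [Measure.finsetSum_apply]
  simp only [Measure.smul_apply, measure_univ, smul_eq_mul, mul_one]
  rw [← ENNReal.ofReal_sum_of_nonneg hw, h1, ENNReal.ofReal_one]

lemma gauss_shift (x : ℝ) (f : ℝ → ℝ) :
    (Integrable f (gaussianReal x 1) ↔ Integrable (fun z => f (z + x)) (gaussianReal 0 1)) ∧
    ∫ t, f t ∂(gaussianReal x 1) = ∫ z, f (z + x) ∂(gaussianReal 0 1) := by
  have h : gaussianReal x 1 = (gaussianReal 0 1).map (fun z => z + x) := by
    rw [gaussianReal_map_add_const, zero_add]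
  have he : MeasurableEmbedding (fun z : ℝ => z + x) := measurableEmbedding_addRight x
  rw [h]
  exact ⟨he.integrable_map_iff, he.integral_map _⟩

lemma std_pow (k : ℕ) : Integrable (fun z : ℝ => z ^ k) (gaussianReal 0 1) := by
  have := (memLp_id_gaussianReal (μ := 0) (v := 1) (k : NNReal))
  have h2 := this.integrable_norm_pow'
  rw [← integrable_norm_iff (by fun_prop)]
  simpa using h2

lemma std_m1 : ∫ z : ℝ, z ∂(gaussianReal 0 1) = 0 := integral_id_gaussianReal

lemma std_m2 : ∫ z : ℝ, z ^ 2 ∂(gaussianReal 0 1) = 1 := by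
  have h := variance_fun_id_gaussianReal (μ := 0) (v := 1)
  rw [variance_of_integral_eq_zero (by fun_prop) std_m1] at h
  simpa using h

lemma std_m3 : ∫ z : ℝ, z ^ 3 ∂(gaussianReal 0 1) = 0 := by
  have h : gaussianReal 0 1 = (gaussianReal 0 1).map (fun z => -z) := by
    rw [gaussianReal_map_neg, neg_zero]
  have he : MeasurableEmbedding (fun z : ℝ => -z) := (MeasurableEquiv.neg ℝ).measurableEmbedding
  have h2 : ∫ z : ℝ, z ^ 3 ∂(gaussianReal 0 1) = - ∫ z : ℝ, z ^ 3 ∂(gaussianReal 0 1) := by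
    conv_lhs => rw [h, he.integral_map]
    rw [← integral_neg]
    congr 1; ext z; ring
  linarith

lemma g_int (x : ℝ) (k : ℕ) : Integrable (fun z : ℝ => z ^ k) (gaussianReal x 1) := by
  have := (memLp_id_gaussianReal (μ := x) (v := 1) (k : NNReal))
  have h2 := this.integrable_norm_pow'
  rw [← integrable_norm_iff (by fun_prop)]
  simpa using h2

lemma g_m2 (x : ℝ) : ∫ z : ℝ, z ^ 2 ∂(gaussianReal x 1) = 1 + x ^ 2 := by
  have i1 := std_pow 1
  have i2 := std_pow 2
  simp only [pow_one] at i1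
  rw [(gauss_shift x _).2]
  have : ∀ z : ℝ, (z + x) ^ 2 = z ^ 2 + ((2 * x) * z + x ^ 2) := fun z => by ring
  simp_rw [this]
  have q1 : Integrable (fun z : ℝ => (2 * x) * z + x ^ 2) (gaussianReal 0 1) := (i1.const_mul _).add (integrable_const _)
  rw [integral_add i2 q1, integral_add (i1.const_mul _) (integrable_const _),
    integral_const_mul, std_m1, std_m2]
  simp

lemma g_m3 (x : ℝ) : ∫ z : ℝ, z ^ 3 ∂(gaussianReal x 1) = 3 * x + x ^ 3 := by
  have i1 := std_pow 1
  have i2 := std_pow 2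
  have i3 := std_pow 3
  simp only [pow_one] at i1
  rw [(gauss_shift x _).2]
  have : ∀ z : ℝ, (z + x) ^ 3 = z ^ 3 + ((3 * x) * z ^ 2 + ((3 * x ^ 2) * z + x ^ 3)) := fun z => by ring
  simp_rw [this]
  have q1 : Integrable (fun z : ℝ => (3 * x ^ 2) * z + x ^ 3) (gaussianReal 0 1) := (i1.const_mul _).add (integrable_const _)
  have q2 : Integrable (fun z : ℝ => (3 * x) * z ^ 2 + ((3 * x ^ 2) * z + x ^ 3)) (gaussianReal 0 1) :=
    (i2.const_mul _).add q1
  rw [integral_add i3 q2, integral_add (i2.const_mul _) q1,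
    integral_add (i1.const_mul _) (integrable_const _),
    integral_const_mul, integral_const_mul, std_m1, std_m2, std_m3]
  simp

noncomputable def BB : ℝ := ∫ z, Real.exp 16 * Real.exp (8 * |z|) ∂(gaussianReal 0 1)

lemma g_T (x : ℝ) (hx : |x| ≤ 1) : Integrable (fun t => TT t ^ 8) (gaussianReal x 1) ∧
    ∫ t, TT t ^ 8 ∂(gaussianReal x 1) ≤ BB := by
  have hi : Integrable (fun z => Real.exp 16 * Real.exp (8 * |z|)) (gaussianReal 0 1) :=
    (integrable_exp_mul_abs (X := fun z => z) (integrable_exp_mul_gaussianReal 8)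
      (integrable_exp_mul_gaussianReal (-8))).const_mul _
  have hle : ∀ z, TT (z + x) ^ 8 ≤ Real.exp 16 * Real.exp (8 * |z|) := fun z => by
    unfold TT
    rw [← Real.exp_add, ← Real.exp_nat_mul]
    apply Real.exp_le_exp.2
    have := abs_add_le z x
    push_cast
    linarith
  have hj : Integrable (fun z => TT (z + x) ^ 8) (gaussianReal 0 1) := by
    refine hi.mono' (by unfold TT; fun_prop) (Filter.Eventually.of_forall fun z => ?_)
    rw [Real.norm_of_nonneg (by unfold TT; positivity)]
    exact hle z
  refine ⟨(gauss_shift x _).1.2 hj, ?_⟩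
  rw [(gauss_shift x _).2]
  exact integral_mono hj hi hle

/-- all properties of the mixture needed in `core` -/
lemma mixT_props {ι : Type*} (S : Finset ι) (w x : ι → ℝ) (hw : ∀ i ∈ S, 0 ≤ w i) (h1 : ∑ i ∈ S, w i = 1)
    (s D xs : ℝ) (hs0 : 0 ≤ s) (hs1 : s ≤ 1) (hx : ∀ i ∈ S, |x i| ≤ s)
    (hD : ∑ i ∈ S, w i * (x i - xs) ^ 2 ≤ D) :
    Integrable (fun t => TT t ^ 8) (mixT S w x) ∧ ∫ t, TT t ^ 8 ∂(mixT S w x) ≤ BB ∧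
    |∫ t, t ∂(mixT S w x)| ≤ 4 * s ∧ |∫ t, t ^ 3 ∂(mixT S w x)| ≤ 4 * s ∧
    |(∫ t, t ^ 2 ∂(mixT S w x)) - (∫ t, t ∂(mixT S w x)) ^ 2 - 1| ≤ D := by
  have e1 : ∫ t, t ∂(mixT S w x) = ∑ i ∈ S, w i * x i := by
    rw [(mixT_integral S w x hw (fun t => t) (fun i _ => by simpa using g_int (x i) 1)).2]
    simp [integral_id_gaussianReal]
  have e2 : ∫ t, t ^ 2 ∂(mixT S w x) = ∑ i ∈ S, w i * (1 + x i ^ 2) := by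
    rw [(mixT_integral S w x hw _ (fun i _ => g_int (x i) 2)).2]
    simp [g_m2]
  have e3 : ∫ t, t ^ 3 ∂(mixT S w x) = ∑ i ∈ S, w i * (3 * x i + x i ^ 3) := by
    rw [(mixT_integral S w x hw _ (fun i _ => g_int (x i) 3)).2]
    simp [g_m3]
  obtain ⟨hi, e8⟩ := mixT_integral S w x hw (fun t => TT t ^ 8) (fun i hi => (g_T (x i) ((hx i hi).trans hs1)).1)
  have avg : ∀ (f : ι → ℝ) (b : ℝ), (∀ i ∈ S, |f i| ≤ b) → |∑ i ∈ S, w i * f i| ≤ b := by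
    intro f b hf
    calc _ ≤ ∑ i ∈ S, |w i * f i| := Finset.abs_sum_le_sum_abs _ _
      _ ≤ ∑ i ∈ S, w i * b := by
        apply Finset.sum_le_sum
        intro i hi
        rw [abs_mul, abs_of_nonneg (hw i hi)]
        exact mul_le_mul_of_nonneg_left (hf i hi) (hw i hi)
      _ = b := by rw [← Finset.sum_mul, h1, one_mul]
  refine ⟨hi, ?_, ?_, ?_, ?_⟩
  · rw [e8]
    calc _ ≤ ∑ i ∈ S, w i * BB := Finset.sum_le_sum fun i hi =>
          mul_le_mul_of_nonneg_left (g_T (x i) ((hx i hi).trans hs1)).2 (hw i hi)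
      _ = BB := by rw [← Finset.sum_mul, h1, one_mul]
  · rw [e1]; exact avg _ _ fun i hi => by linarith [hx i hi]
  · rw [e3]; refine avg _ _ fun i hi => ?_
    have h := hx i hi
    have h3 : |x i| ^ 3 ≤ s := by
      calc |x i| ^ 3 ≤ s ^ 3 := pow_le_pow_left₀ (abs_nonneg _) h _
        _ ≤ s := pow_le_of_le_one hs0 hs1 (by norm_num)
    refine (abs_add_le _ _).trans ?_
    rw [abs_mul, abs_pow, abs_of_pos (by norm_num : (0:ℝ) < 3)]
    linarith
  · rw [e1, e2]
    set m := ∑ i ∈ S, w i * x i with hm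
    have k1 : ∑ i ∈ S, w i * (1 + x i ^ 2) = 1 + ∑ i ∈ S, w i * x i ^ 2 := by
      simp only [mul_add, mul_one, Finset.sum_add_distrib, h1]
    have k2 : ∀ a : ℝ, ∑ i ∈ S, w i * (x i - a) ^ 2 = ∑ i ∈ S, w i * x i ^ 2 - 2 * a * m + a ^ 2 := by
      intro a
      have : ∀ i, w i * (x i - a) ^ 2 = w i * x i ^ 2 - (2 * a) * (w i * x i) + a ^ 2 * w i := fun i => by ring
      simp_rw [this]
      rw [Finset.sum_add_distrib, Finset.sum_sub_distrib, ← Finset.mul_sum, ← Finset.mul_sum, h1, ← hm]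
      ring
    have k3 : 0 ≤ ∑ i ∈ S, w i * (x i - m) ^ 2 :=
      Finset.sum_nonneg fun i hi => mul_nonneg (hw i hi) (sq_nonneg _)
    rw [k2] at k3 hD
    rw [k1, abs_le]
    constructor <;> nlinarith [sq_nonneg (xs - m)]

lemma mix_map {ι : Type*} (S : Finset ι) (w m : ι → ℝ) (H σ : ℝ) (hσ : 0 < σ) :
    ∑ i ∈ S, ENNReal.ofReal (w i) • gaussianReal (m i) (σ ^ 2).toNNReal =
      (mixT S w (fun i => (m i - H) / σ)).map (fun t => H + σ * t) := by
  unfold mixT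
  rw [Measure.map_finset_sum (by fun_prop)]
  apply Finset.sum_congr rfl
  intro i hi
  rw [Measure.map_smul]
  congr 1
  have : (fun t : ℝ => H + σ * t) = (fun t => H + t) ∘ (fun t => σ * t) := rfl
  rw [this, ← Measure.map_map (by fun_prop) (by fun_prop), gaussianReal_map_const_mul, gaussianReal_map_const_add]
  congr 1
  · field_simp; ring
  · ext; simp [Real.coe_toNNReal _ (sq_nonneg σ)]

lemma var_map (ν : Measure ℝ) (H σ : ℝ) (hσ : 0 < σ) (f : ℝ → ℝ) :
    varAgainst (ν.map (fun t => H + σ * t)) f = varAgainst ν (fun t => f (H + σ * t)) := by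
  have he : MeasurableEmbedding (fun t : ℝ => H + σ * t) :=
    (measurableEmbedding_addLeft H).comp (measurableEmbedding_mulLeft₀ hσ.ne')
  unfold varAgainst
  rw [he.integral_map, he.integral_map]

lemma mix_density_s16 {ι : Type*} (S : Finset ι) (w m : ι → ℝ) (hw : ∀ i ∈ S, 0 ≤ w i) (v : NNReal) (hv : v ≠ 0) :
    ∑ i ∈ S, ENNReal.ofReal (w i) • gaussianReal (m i) v =
      (volume : Measure ℝ).withDensity (fun y => ENNReal.ofReal (∑ i ∈ S, w i * gaussianPDFReal (m i) v y)) := by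
  classical
  induction S using Finset.induction_on with
  | empty => simp
  | insert a S ha ih =>
    rw [Finset.sum_insert ha, ih (fun i hi => hw i (Finset.mem_insert_of_mem hi)), gaussianReal_of_var_ne_zero _ hv,
      ← withDensity_smul _ (measurable_gaussianPDF _ _), ← withDensity_add_left]
    · congr 1
      ext y
      rw [Finset.sum_insert ha, ENNReal.ofReal_add]
      · simp only [Pi.add_apply, Pi.smul_apply, smul_eq_mul, gaussianPDF]
        rw [ENNReal.ofReal_mul (hw a (Finset.mem_insert_self _ _))]
      · exact mul_nonneg (hw a (Finset.mem_insert_self _ _)) (gaussianPDFReal_nonneg _ _ _)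
      · exact Finset.sum_nonneg fun i hi => mul_nonneg (hw i (Finset.mem_insert_of_mem hi)) (gaussianPDFReal_nonneg _ _ _)
    · exact (measurable_gaussianPDF _ _).const_smul _

lemma rn_aux (P Q : Measure ℝ) [SigmaFinite Q] (p d : ℝ → ℝ) (hp : Measurable p) (hd : Measurable d)
    (hp0 : ∀ y, 0 ≤ p y) (hd0 : ∀ y, 0 < d y)
    (hP : P = (volume : Measure ℝ).withDensity (fun y => ENNReal.ofReal (p y)))
    (hQ : Q = (volume : Measure ℝ).withDensity (fun y => ENNReal.ofReal (d y))) :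
    (∀ᵐ y ∂Q, (P.rnDeriv Q y).toReal = p y / d y) ∧ (∀ᵐ y ∂P, (P.rnDeriv Q y).toReal = p y / d y) := by
  have hm : Measurable (fun y => ENNReal.ofReal (p y / d y)) := (hp.div hd).ennreal_ofReal
  have hPQ : P = Q.withDensity (fun y => ENNReal.ofReal (p y / d y)) := by
    rw [hP, hQ, ← withDensity_mul _ hd.ennreal_ofReal hm]
    congr 1
    ext y
    rw [Pi.mul_apply, ← ENNReal.ofReal_mul (hd0 y).le, mul_div_cancel₀ _ (hd0 y).ne']
  have h1 : ∀ᵐ y ∂Q, (P.rnDeriv Q y).toReal = p y / d y := by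
    have := Measure.rnDeriv_withDensity Q hm
    rw [← hPQ] at this
    filter_upwards [this] with y hy
    rw [hy, ENNReal.toReal_ofReal (div_nonneg (hp0 y) (hd0 y).le)]
  have hac : P ≪ Q := by
    conv_lhs => rw [hPQ]
    exact withDensity_absolutelyContinuous _ _
  exact ⟨h1, hac.ae_le h1⟩

noncomputable def WW (m : ℕ) (q : ℝ) (J : Finset ℕ) : ℝ := q ^ J.card * (1 - q) ^ (m - J.card)

lemma WW_nonneg (m : ℕ) (q : ℝ) (h0 : 0 < q) (h1 : q < 1) (J : Finset ℕ) : 0 ≤ WW m q J := by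
  unfold WW
  have : 0 < 1 - q := by linarith
  positivity

lemma WW_sum (m : ℕ) (q : ℝ) : ∑ J ∈ (Finset.range m).powerset, WW m q J = 1 := by
  have := Finset.sum_pow_mul_eq_add_pow q (1 - q) (Finset.range m)
  simpa [WW] using this

lemma WW_le (m : ℕ) (q : ℝ) (h0 : 0 < q) (h1 : q < 1) (J : Finset ℕ) (hJ : J ∈ (Finset.range m).powerset)
    (hne : J ≠ Finset.range m) : WW m q J ≤ 1 - q := by
  have h2 : 0 < 1 - q := by linarith
  have hc : J.card < m := by
    have := Finset.card_lt_card (Finset.ssubset_iff_subset_ne.2 ⟨Finset.mem_powerset.1 hJ, hne⟩)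
    simpa using this
  unfold WW
  calc _ ≤ 1 * (1 - q) := by
        gcongr
        · exact pow_le_one₀ h0.le h1.le
        · exact pow_le_of_le_one h2.le (by linarith) (by omega)
    _ = _ := one_mul _

lemma WW_full (n : ℕ) (q : ℝ) (h1 : q < 1) (hq : 1 - q ≤ 1 / (2 * (n + 1))) :
    1 / 2 ≤ WW n q (Finset.range n) := by
  have hn : (0:ℝ) ≤ n := Nat.cast_nonneg n
  have h3 : (n : ℝ) * (1 - q) ≤ 1 / 2 := by
    rw [le_div_iff₀ (by positivity)] at hq
    nlinarith
  have h4 : (1:ℝ) / (2 * (n + 1)) ≤ 1 := by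
    rw [div_le_one (by positivity)]; linarith
  have := one_add_mul_le_pow (a := q - 1) (by linarith) n
  unfold WW
  simp only [Finset.card_range, tsub_self, pow_zero, mul_one]
  have h5 : 1 + (q - 1) = q := by ring
  rw [h5] at this
  linarith

lemma WW_split (n : ℕ) (q : ℝ) (f : Finset ℕ → ℝ) :
    ∑ J ∈ (Finset.range (n + 1)).powerset, WW (n + 1) q J * f J =
      ∑ J ∈ (Finset.range n).powerset, WW n q J * ((1 - q) * f J + q * f (insert n J)) := by
  rw [Finset.range_add_one, Finset.sum_powerset_insert (by simp), ← Finset.sum_add_distrib]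
  apply Finset.sum_congr rfl
  intro J hJ
  have hsub := Finset.mem_powerset.1 hJ
  have hc : J.card ≤ n := by simpa using Finset.card_le_card hsub
  have hn : n ∉ J := fun h => by simpa using hsub h
  unfold WW
  rw [Finset.card_insert_of_notMem hn]
  have e1 : n + 1 - J.card = (n - J.card) + 1 := by omega
  have e2 : n + 1 - (J.card + 1) = n - J.card := by omega
  rw [e1, e2]
  ring

lemma pdf_aux (m H σ t : ℝ) (hσ : 0 < σ) : gaussianPDFReal m (σ ^ 2).toNNReal (H + σ * t) =
    ((√(2 * Real.pi * σ ^ 2))⁻¹ * Real.exp (-(t ^ 2) / 2)) *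
      Real.exp ((m - H) / σ * t - ((m - H) / σ) ^ 2 / 2) := by
  rw [gaussianPDFReal_def]
  simp only [Real.coe_toNNReal _ (sq_nonneg σ)]
  have h : Real.exp (-(H + σ * t - m) ^ 2 / (2 * σ ^ 2)) = Real.exp (-(t ^ 2) / 2) *
      Real.exp ((m - H) / σ * t - ((m - H) / σ) ^ 2 / 2) := by
    rw [← Real.exp_add]
    congr 1
    field_simp
    ring
  rw [h]
  ring

lemma sumFn_abs (g : ℕ → ℝ) (m : ℕ) (J : Finset ℕ) (hJ : J ⊆ Finset.range m) :
    |sumFn g J| ≤ ∑ j ∈ Finset.range m, |g j| := by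
  unfold sumFn
  exact (Finset.abs_sum_le_sum_abs _ _).trans (Finset.sum_le_sum_of_subset_of_nonneg hJ fun _ _ _ => abs_nonneg _)

/-- the privacy loss in the normalised variable -/
noncomputable def ell (n : ℕ) (g : ℕ → ℝ) (σ q t : ℝ) : ℝ :=
  Real.log ((∑ J ∈ (Finset.range (n + 1)).powerset, WW (n + 1) q J *
      gaussianPDFReal (sumFn g J) (σ ^ 2).toNNReal (sumFn g (Finset.range n) + σ * t)) /
    (∑ J ∈ (Finset.range n).powerset, WW n q J *
      gaussianPDFReal (sumFn g J) (σ ^ 2).toNNReal (sumFn g (Finset.range n) + σ * t)))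

lemma ell_meas (n : ℕ) (g : ℕ → ℝ) (σ q : ℝ) : Measurable (ell n g σ q) := by
  unfold ell
  have : ∀ m v, Measurable (gaussianPDFReal m v) := measurable_gaussianPDFReal
  fun_prop

lemma ell_eq (n : ℕ) (g : ℕ → ℝ) (σ q t : ℝ) (hσ : 0 < σ) (hd : 0 < 
      ∑ J ∈ (Finset.range n).powerset, WW n q J * Real.exp ((sumFn g J - sumFn g (Finset.range n)) / σ * t
        - ((sumFn g J - sumFn g (Finset.range n)) / σ) ^ 2 / 2)) :
    ell n g σ q t = Real.log ((1 - q) + (1 - (1 - q)) * Real.exp (g n / σ * t - (g n / σ) ^ 2 / 2) *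
      ((∑ J ∈ (Finset.range n).powerset, WW n q J * (Real.exp ((sumFn g J - sumFn g (Finset.range n)) / σ * t
        - ((sumFn g J - sumFn g (Finset.range n)) / σ) ^ 2 / 2) *
          Real.exp (-((sumFn g J - sumFn g (Finset.range n)) / σ * (g n / σ))))) /
      (∑ J ∈ (Finset.range n).powerset, WW n q J * Real.exp ((sumFn g J - sumFn g (Finset.range n)) / σ * t
        - ((sumFn g J - sumFn g (Finset.range n)) / σ) ^ 2 / 2)))) := by
  unfold ell
  congr 1
  rw [WW_split]
  simp only [pdf_aux _ _ _ _ hσ]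
  set H := sumFn g (Finset.range n) with hH
  set κ := (√(2 * Real.pi * σ ^ 2))⁻¹ * Real.exp (-(t ^ 2) / 2) with hκ
  have hκ0 : 0 < κ := by positivity
  set F := ∑ J ∈ (Finset.range n).powerset, WW n q J * Real.exp ((sumFn g J - H) / σ * t
        - ((sumFn g J - H) / σ) ^ 2 / 2) with hF
  set Fg := (∑ J ∈ (Finset.range n).powerset, WW n q J * (Real.exp ((sumFn g J - H) / σ * t
        - ((sumFn g J - H) / σ) ^ 2 / 2) * Real.exp (-((sumFn g J - H) / σ * (g n / σ))))) with hFg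
  have e1 : ∑ J ∈ (Finset.range n).powerset, WW n q J * (κ * Real.exp ((sumFn g J - H) / σ * t
        - ((sumFn g J - H) / σ) ^ 2 / 2)) = κ * F := by
    rw [hF, Finset.mul_sum]; apply Finset.sum_congr rfl; intros; ring
  have e2 : ∑ J ∈ (Finset.range n).powerset, WW n q J * ((1 - q) * (κ * Real.exp ((sumFn g J - H) / σ * t
        - ((sumFn g J - H) / σ) ^ 2 / 2)) + q * (κ * Real.exp ((sumFn g (insert n J) - H) / σ * t
        - ((sumFn g (insert n J) - H) / σ) ^ 2 / 2))) =
        κ * ((1 - q) * F + q * Real.exp (g n / σ * t - (g n / σ) ^ 2 / 2) * Fg) := by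
    rw [hF, hFg, Finset.mul_sum, Finset.mul_sum, ← Finset.sum_add_distrib, Finset.mul_sum]
    apply Finset.sum_congr rfl
    intro J hJ
    have hn : n ∉ J := fun h => by simpa using (Finset.mem_powerset.1 hJ) h
    have h1 : sumFn g (insert n J) = g n + sumFn g J := by
      unfold sumFn; rw [Finset.sum_insert hn]
    have h2 : Real.exp ((sumFn g (insert n J) - H) / σ * t - ((sumFn g (insert n J) - H) / σ) ^ 2 / 2) =
        Real.exp (g n / σ * t - (g n / σ) ^ 2 / 2) * (Real.exp ((sumFn g J - H) / σ * t
        - ((sumFn g J - H) / σ) ^ 2 / 2) * Real.exp (-((sumFn g J - H) / σ * (g n / σ)))) := by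
      rw [h1, ← Real.exp_add, ← Real.exp_add]
      congr 1
      ring
    rw [h2]
    ring
  rw [e1, e2, mul_div_mul_left _ _ hκ0.ne']
  field_simp
  ring

lemma var_congr (μ : Measure ℝ) (f h : ℝ → ℝ) (hfh : ∀ᵐ y ∂μ, f y = h y) : varAgainst μ f = varAgainst μ h := by
  unfold varAgainst
  have h1 : ∫ y, f y ^ 2 ∂μ = ∫ y, h y ^ 2 ∂μ := integral_congr_ae (hfh.mono fun y hy => by simp only [hy])
  have h2 : ∫ y, f y ∂μ = ∫ y, h y ∂μ := integral_congr_ae hfh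
  rw [h1, h2]

noncomputable def xx (n : ℕ) (g : ℕ → ℝ) (σ : ℝ) (J : Finset ℕ) : ℝ :=
  (sumFn g J - sumFn g (Finset.range n)) / σ

lemma var_red (n : ℕ) (g : ℕ → ℝ) (σ q : ℝ) (hσ : 0 < σ) (h0 : 0 < q) (h1 : q < 1) :
    varAgainst (subsampledP n σ q (sumFn g)) (privacyLoss n σ q (sumFn g)) =
      varAgainst (mixT (Finset.range (n + 1)).powerset (WW (n + 1) q) (xx n g σ)) (ell n g σ q) ∧
    varAgainst (subsampledQ n σ q (sumFn g)) (privacyLoss n σ q (sumFn g)) =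
      varAgainst (mixT (Finset.range n).powerset (WW n q) (xx n g σ)) (ell n g σ q) := by
  have hv : (σ ^ 2).toNNReal ≠ 0 := by simpa using hσ.ne'
  set H := sumFn g (Finset.range n) with hH
  have hPm : subsampledP n σ q (sumFn g) = (mixT (Finset.range (n + 1)).powerset (WW (n + 1) q) (xx n g σ)).map (fun t => H + σ * t) :=
    mix_map _ (WW (n + 1) q) (sumFn g) H σ hσ
  have hQm : subsampledQ n σ q (sumFn g) = (mixT (Finset.range n).powerset (WW n q) (xx n g σ)).map (fun t => H + σ * t) :=
    mix_map _ (WW n q) (sumFn g) H σ hσ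
  have hPd := mix_density_s16 (Finset.range (n + 1)).powerset (WW (n + 1) q) (sumFn g) (fun J _ => WW_nonneg _ q h0 h1 J) _ hv
  have hQd := mix_density_s16 (Finset.range n).powerset (WW n q) (sumFn g) (fun J _ => WW_nonneg _ q h0 h1 J) _ hv
  have hprob := mixT_prob (Finset.range n).powerset (WW n q) (xx n g σ) (fun J _ => WW_nonneg _ q h0 h1 J) (WW_sum n q)
  have hfin : IsProbabilityMeasure (subsampledQ n σ q (sumFn g)) := by
    rw [hQm]; exact Measure.isProbabilityMeasure_map (by fun_prop)
  have hmeas : ∀ m v, Measurable (gaussianPDFReal m v) := measurable_gaussianPDFReal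
  obtain ⟨a1, a2⟩ := rn_aux (subsampledP n σ q (sumFn g)) (subsampledQ n σ q (sumFn g)) _ _ (by fun_prop) (by fun_prop)
    (fun y => Finset.sum_nonneg fun J _ => mul_nonneg (WW_nonneg _ q h0 h1 J) (gaussianPDFReal_nonneg _ _ _))
    (fun y => by
      have h2 : 0 < 1 - q := by linarith
      refine Finset.sum_pos (fun J _ => mul_pos (by unfold WW; positivity) (gaussianPDFReal_pos _ _ _ hv)) ⟨∅, by simp⟩) hPd hQd
  constructor
  · rw [var_congr _ _ _ (a2.mono fun y hy => by unfold privacyLoss; exact congrArg Real.log hy), hPm, var_map _ _ _ hσ]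
    rfl
  · rw [var_congr _ _ _ (a1.mono fun y hy => by unfold privacyLoss; exact congrArg Real.log hy), hQm, var_map _ _ _ hσ]
    rfl

lemma one_le_BB : 1 ≤ BB := by
  have h := g_T 0 (by simp)
  refine le_trans ?_ h.2
  have : ∫ t : ℝ, (1:ℝ) ∂(gaussianReal 0 1) = 1 := by simp
  rw [← this]
  exact integral_mono (integrable_const _) h.1 fun t => one_le_pow₀ (one_le_TT t)

lemma final_aux (n m : ℕ) (hm : m ≤ n + 1) (g : ℕ → ℝ) (A σ q : ℝ) (hA : A = 1 + 2 * ∑ j ∈ Finset.range (n + 1), |g j|)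
    (h0 : 0 < q) (h1 : q < 1) (hq : 1 - q ≤ 1 / (2 * (n + 1))) (hσ : A ≤ σ) :
    |varAgainst (mixT (Finset.range m).powerset (WW m q) (xx n g σ)) (ell n g σ q) - q ^ 2 * (g n) ^ 2 / σ ^ 2| ≤
      (50 * (110 * (2 ^ n) ^ 2) ^ 2 * (4 * 2 ^ (n + 1)) * BB ^ 2 * A ^ 4) * ((1 - q) / σ ^ 4 + (1 - q) ^ 2) := by
  have hsum : 0 ≤ ∑ j ∈ Finset.range (n + 1), |g j| := Finset.sum_nonneg fun _ _ => abs_nonneg _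
  have hA1 : 1 ≤ A := by linarith
  have hσ0 : 0 < σ := by linarith
  set s := A / σ with hs
  have hs0 : 0 ≤ s := by positivity
  have hs1 : s ≤ 1 := by rw [hs, div_le_one hσ0]; exact hσ
  set δ := 1 - q with hδ
  have hδ0 : 0 < δ := by linarith
  have hδ2 : δ ≤ 1 / 2 := hq.trans (by
    apply one_div_le_one_div_of_le (by norm_num)
    have : (0:ℝ) ≤ n := Nat.cast_nonneg n
    linarith)
  have hxx : ∀ J ⊆ Finset.range (n + 1), |xx n g σ J| ≤ s := by
    intro J hJ
    unfold xx
    rw [abs_div, abs_of_pos hσ0, hs]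
    gcongr
    have a1 := sumFn_abs g _ J hJ
    have a2 := sumFn_abs g (n + 1) (Finset.range n) (Finset.range_subset_range.2 (Nat.le_succ n))
    refine (abs_sub _ _).trans ?_
    linarith
  have hγ : |g n / σ| ≤ s := by
    rw [abs_div, abs_of_pos hσ0, hs]
    gcongr
    have := Finset.single_le_sum (f := fun j => |g j|) (fun j _ => abs_nonneg (g j)) (Finset.self_mem_range_succ n)
    linarith
  have hprob := mixT_prob (Finset.range m).powerset (WW m q) (xx n g σ) (fun J _ => WW_nonneg _ q h0 h1 J) (WW_sum m q)
  have hsubm : ∀ J ∈ (Finset.range m).powerset, J ⊆ Finset.range (n + 1) := fun J hJ =>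
    (Finset.mem_powerset.1 hJ).trans (Finset.range_subset_range.2 hm)
  have hD : ∑ J ∈ (Finset.range m).powerset, WW m q J * (xx n g σ J - xx n g σ (Finset.range m)) ^ 2 ≤
      4 * 2 ^ (n + 1) * δ * s ^ 2 := by
    calc _ ≤ ∑ J ∈ (Finset.range m).powerset, δ * (2 * s) ^ 2 := by
          apply Finset.sum_le_sum
          intro J hJ
          by_cases h : J = Finset.range m
          · rw [h, sub_self]; simp; positivity
          · have a1 := WW_le m q h0 h1 J hJ h
            have a2 : (xx n g σ J - xx n g σ (Finset.range m)) ^ 2 ≤ (2 * s) ^ 2 := by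
              rw [← sq_abs]
              apply pow_le_pow_left₀ (abs_nonneg _)
              refine (abs_sub _ _).trans ?_
              linarith [hxx J (hsubm J hJ), hxx _ (hsubm _ (Finset.mem_powerset_self _))]
            exact mul_le_mul a1 a2 (sq_nonneg _) hδ0.le
      _ = 2 ^ m * (δ * (2 * s) ^ 2) := by
          rw [Finset.sum_const, Finset.card_powerset, Finset.card_range, nsmul_eq_mul]; push_cast; ring
      _ ≤ 2 ^ (n + 1) * (δ * (2 * s) ^ 2) := by
          gcongr; norm_num
      _ = _ := by ring
  have h2n : (1:ℝ) ≤ 2 ^ n := one_le_pow₀ (by norm_num)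
  have h2n1 : (1:ℝ) ≤ 2 ^ (n + 1) := one_le_pow₀ (by norm_num)
  obtain ⟨p1, p2, p3, p4, p5⟩ := mixT_props (Finset.range m).powerset (WW m q) (xx n g σ)
    (fun J _ => WW_nonneg _ q h0 h1 J) (WW_sum m q) s _ _ hs0 hs1 (fun J hJ => hxx J (hsubm J hJ)) hD
  have hx0 : xx n g σ (Finset.range n) = 0 := by simp [xx]
  have hfull := WW_full n q h1 hq
  have hptw : ∀ t, |ell n g σ q t - ((∑ i ∈ (Finset.range n).powerset, WW n q i * (Real.exp (-(xx n g σ i * (g n / σ))) - 1)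
      - (1 - δ) * (g n / σ) ^ 2 / 2) + (1 - δ) * (g n / σ) * t +
        δ * (g n / σ) ^ 2 / 2 * t ^ 2)| ≤ (110 * (2 ^ n) ^ 2) * (δ * s ^ 3 + δ ^ 2) * TT t ^ 4 := by
    intro t
    have hpos : 0 < ∑ J ∈ (Finset.range n).powerset, WW n q J * Real.exp ((sumFn g J - sumFn g (Finset.range n)) / σ * t
        - ((sumFn g J - sumFn g (Finset.range n)) / σ) ^ 2 / 2) :=
      Finset.sum_pos' (fun J _ => mul_nonneg (WW_nonneg _ q h0 h1 J) (Real.exp_pos _).le)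
        ⟨Finset.range n, Finset.mem_powerset_self _, mul_pos (by linarith) (Real.exp_pos _)⟩
    rw [ell_eq n g σ q t hσ0 hpos]
    have := ptw (Finset.range n).powerset (WW n q) (xx n g σ) (Finset.range n) (Finset.mem_powerset_self _) hx0
      (fun J _ => WW_nonneg _ q h0 h1 J) (WW_sum n q) hfull δ s (g n / σ) t
      (fun J hJ hne => WW_le n q h0 h1 J hJ hne) hδ0 hδ2 hs0 hs1
      (fun J hJ => hxx J ((Finset.mem_powerset.1 hJ).trans (Finset.range_subset_range.2 (Nat.le_succ n)))) hγ
    rw [Finset.card_powerset, Finset.card_range] at this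
    push_cast at this
    exact this
  have hC : (1:ℝ) ≤ 110 * (2 ^ n) ^ 2 := by
    have : (1:ℝ) ≤ (2 ^ n) ^ 2 := one_le_pow₀ h2n
    linarith
  have hK : (4:ℝ) ≤ 4 * 2 ^ (n + 1) := by linarith
  have := core (mixT (Finset.range m).powerset (WW m q) (xx n g σ)) (110 * (2 ^ n) ^ 2) (4 * 2 ^ (n + 1)) BB hC
    (by linarith) one_le_BB p1 p2 δ s (g n / σ) _ hδ0 hδ2 hs0 hs1 hγ (p3.trans (by gcongr)) (p4.trans (by gcongr)) p5
    (ell n g σ q) (ell_meas n g σ q) hptw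
  have e1 : (1 - δ) ^ 2 * (g n / σ) ^ 2 = q ^ 2 * (g n) ^ 2 / σ ^ 2 := by
    rw [hδ]; field_simp; ring
  rw [e1] at this
  refine this.trans ?_
  have hZ : δ * s ^ 4 + δ ^ 2 ≤ A ^ 4 * (δ / σ ^ 4 + δ ^ 2) := by
    have e2 : δ * s ^ 4 = A ^ 4 * (δ / σ ^ 4) := by rw [hs]; field_simp
    rw [e2, mul_add]
    have : (1:ℝ) ≤ A ^ 4 := one_le_pow₀ hA1
    have := le_mul_of_one_le_left (sq_nonneg δ) this
    linarith
  have hBB := one_le_BB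
  calc _ ≤ (50 * (110 * (2 ^ n) ^ 2) ^ 2 * (4 * 2 ^ (n + 1)) * BB ^ 2) * (A ^ 4 * (δ / σ ^ 4 + δ ^ 2)) := by gcongr
    _ = _ := by ring


/-- **Large sampling-rate / large noise approximation of the variance of the privacy
loss of the Poisson-subsampled Gaussian mechanism.**  With `h(J) = Σ_{j∈J} g j` and
`μ = |g n|`, in the joint limit `q̂ = 1 − q → 0`, `σ → ∞`:
`Var_{P_{q,σ}}[L_{q,σ}] = q² μ²/σ² + q̂·O(1/σ⁴) + O(q̂²)` and likewise under `Q`. -/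
theorem subsampledGaussian_var_privacyLoss_large_q
    (n : ℕ) (g : ℕ → ℝ) :
    ∃ C > (0 : ℝ), ∃ ε ∈ Set.Ioo (0 : ℝ) 1, ∃ σ₀ > (0 : ℝ),
      ∀ q ∈ Set.Ioo (0 : ℝ) 1, 1 - q ≤ ε → ∀ σ : ℝ, σ₀ ≤ σ →
        |varAgainst (subsampledP n σ q (sumFn g)) (privacyLoss n σ q (sumFn g)) -
            q ^ 2 * (g n) ^ 2 / σ ^ 2|
          ≤ C * ((1 - q) / σ ^ 4 + (1 - q) ^ 2) ∧
        |varAgainst (subsampledQ n σ q (sumFn g)) (privacyLoss n σ q (sumFn g)) -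
            q ^ 2 * (g n) ^ 2 / σ ^ 2|
          ≤ C * ((1 - q) / σ ^ 4 + (1 - q) ^ 2) := by
  have hsum : 0 ≤ ∑ j ∈ Finset.range (n + 1), |g j| := Finset.sum_nonneg fun _ _ => abs_nonneg _
  have hn : (0:ℝ) ≤ n := Nat.cast_nonneg n
  have hBB := one_le_BB
  refine ⟨50 * (110 * (2 ^ n) ^ 2) ^ 2 * (4 * 2 ^ (n + 1)) * BB ^ 2 *
    (1 + 2 * ∑ j ∈ Finset.range (n + 1), |g j|) ^ 4, by positivity, 1 / (2 * (n + 1)), ⟨by positivity, ?_⟩,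
    1 + 2 * ∑ j ∈ Finset.range (n + 1), |g j|, by positivity, ?_⟩
  · rw [div_lt_one (by positivity)]; linarith
  · rintro q ⟨h0, h1⟩ hq σ hσ
    obtain ⟨e1, e2⟩ := var_red n g σ q (by linarith) h0 h1
    rw [e1, e2]
    exact ⟨final_aux n (n + 1) le_rfl g _ σ q rfl h0 h1 hq hσ, final_aux n n (Nat.le_succ n) g _ σ q rfl h0 h1 hq hσ⟩
end
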